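/- Let d ≥ 2, p ≥ d, and R₀ > 0. If u and v are positive C¹ weak solutions of the p-Laplace equation -Δ_p w = 0 in the exterior domain { x ∈ ℝ^d : ‖x‖ > R₀ }, then the limit lim_{‖x‖ → ∞} u(x)/v(x) exists in the extended interval [0, +∞]. -/

import Mathlib

open MeasureTheory Metric Filter Topology Set
open scoped RealInnerProductSpace ENNReal

noncomputable section

/-- `u` is a positive `C¹` weak solution of `-Δ_p u + V|u|^{p-2}u = 0` in the open set `Ω`. -/
def IsPosWeakSol {d : ℕ} (p : ℝ) (V : EuclideanSpace ℝ (Fin d) → ℝ)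
    (Ω : Set (EuclideanSpace ℝ (Fin d))) (u : EuclideanSpace ℝ (Fin d) → ℝ) : Prop :=
  ContDiffOn ℝ 1 u Ω ∧ (∀ x ∈ Ω, 0 < u x) ∧
  ∀ φ : EuclideanSpace ℝ (Fin d) → ℝ, ContDiff ℝ (⊤ : ℕ∞) φ → HasCompactSupport φ →
    tsupport φ ⊆ Ω →
    ∫ x in Ω, (‖gradient u x‖ ^ (p - 2) * ⟪gradient u x, gradient φ x⟫ +
      V x * |u x| ^ (p - 2) * u x * φ x) = 0

section Comparison

variable {E : Type*} [NormedAddCommGroup E] [InnerProductSpace ℝ E]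

/-- The nonlinear flux `ξ ↦ |ξ|^{p-2} ξ` of the `p`-Laplacian. -/
def flux (p : ℝ) (ξ : E) : E := ‖ξ‖ ^ (p - 2) • ξ

theorem flux_neg (p : ℝ) (ξ : E) : flux p (-ξ) = -flux p ξ := by simp [flux]

theorem flux_zero (p : ℝ) : flux p (0 : E) = 0 := by simp [flux]

theorem flux_smul (p : ℝ) {c : ℝ} (hc : 0 < c) (ξ : E) :
    flux p (c • ξ) = c ^ (p - 1) • flux p ξ := by
  have h : c ^ (p - 1) = c ^ (p - 2) * c := by
    rw [← Real.rpow_add_one hc.ne']; ring_nf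
  simp only [flux, norm_smul, Real.norm_eq_abs, abs_of_pos hc,
    Real.mul_rpow hc.le (norm_nonneg ξ), smul_smul, h]
  ring_nf

theorem continuous_flux {p : ℝ} (hp : 2 ≤ p) : Continuous (flux p : E → E) :=
  (continuous_norm.rpow_const fun _ => Or.inr (by linarith)).smul continuous_id

theorem inner_flux_sub_eq (p : ℝ) (ξ ζ : E) :
    ⟪flux p ξ - flux p ζ, ξ - ζ⟫ =
      (‖ξ‖ ^ (p - 2) + ‖ζ‖ ^ (p - 2)) / 2 * ‖ξ - ζ‖ ^ 2 +
      (‖ξ‖ ^ (p - 2) - ‖ζ‖ ^ (p - 2)) * (‖ξ‖ ^ 2 - ‖ζ‖ ^ 2) / 2 := by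
  rw [@norm_sub_sq_real]
  simp only [flux, inner_sub_left, inner_sub_right, real_inner_smul_left,
    real_inner_self_eq_norm_sq, real_inner_comm ξ ζ]
  ring

theorem rpow_sub_mul_sq_sub_nonneg {q a b : ℝ} (hq : 0 ≤ q) (ha : 0 ≤ a) (hb : 0 ≤ b) :
    0 ≤ (a ^ q - b ^ q) * (a ^ 2 - b ^ 2) := by
  rcases le_total a b with h | h
  · exact mul_nonneg_of_nonpos_of_nonpos (sub_nonpos.2 (Real.rpow_le_rpow ha h hq))
      (sub_nonpos.2 (by gcongr))
  · exact mul_nonneg (sub_nonneg.2 (Real.rpow_le_rpow hb h hq)) (sub_nonneg.2 (by gcongr))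

theorem inner_flux_sub_nonneg {p : ℝ} (hp : 2 ≤ p) (ξ ζ : E) :
    0 ≤ ⟪flux p ξ - flux p ζ, ξ - ζ⟫ := by
  rw [inner_flux_sub_eq]
  have := rpow_sub_mul_sq_sub_nonneg (sub_nonneg.2 hp) (norm_nonneg ξ) (norm_nonneg ζ)
  positivity

theorem eq_of_inner_flux_sub_eq_zero {p : ℝ} (hp : 2 ≤ p) {ξ ζ : E}
    (h : ⟪flux p ξ - flux p ζ, ξ - ζ⟫ = 0) : ξ = ζ := by
  rw [inner_flux_sub_eq] at h
  have h1 := rpow_sub_mul_sq_sub_nonneg (sub_nonneg.2 hp) (norm_nonneg ξ) (norm_nonneg ζ)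
  by_contra hne
  have h2 : 0 < ‖ξ - ζ‖ := norm_pos_iff.2 (sub_ne_zero.2 hne)
  have h3 : 0 < ‖ξ‖ ^ (p - 2) + ‖ζ‖ ^ (p - 2) := by
    by_cases hξ : ξ = 0
    · have : 0 < ‖ζ‖ := norm_pos_iff.2 fun h => hne (by rw [hξ, h])
      positivity
    · have : 0 < ‖ξ‖ := norm_pos_iff.2 hξ
      positivity
  have : 0 < (‖ξ‖ ^ (p - 2) + ‖ζ‖ ^ (p - 2)) / 2 * ‖ξ - ζ‖ ^ 2 := by positivity
  linarith

theorem continuous_inner_of_tsupport_subset {Ω : Set E} (hΩ : IsOpen Ω) {X Y : E → E}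
    (hX : ContinuousOn X Ω) (hY : Continuous Y) (hYΩ : tsupport Y ⊆ Ω) :
    Continuous fun x => ⟪X x, Y x⟫ := by
  refine continuous_iff_continuousAt.2 fun x => ?_
  by_cases hx : x ∈ Ω
  · exact (hX.continuousAt (hΩ.mem_nhds hx)).inner hY.continuousAt
  · have h0 : Y =ᶠ[𝓝 x] 0 := notMem_tsupport_iff_eventuallyEq.1 fun h => hx (hYΩ h)
    refine (continuousAt_const (y := (0 : ℝ))).congr ?_
    filter_upwards [h0] with y hy
    simp [hy]

variable [FiniteDimensional ℝ E]

theorem ContDiffOn.continuousOn_gradient {Ω : Set E} (hΩ : IsOpen Ω) {u : E → ℝ}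
    (hu : ContDiffOn ℝ 1 u Ω) : ContinuousOn (gradient u) Ω :=
  (InnerProductSpace.toDual ℝ E).symm.continuous.comp_continuousOn
    (hu.continuousOn_fderiv_of_isOpen hΩ le_rfl)

theorem ContDiff.continuous_gradient {u : E → ℝ} (hu : ContDiff ℝ 1 u) :
    Continuous (gradient u) :=
  (InnerProductSpace.toDual ℝ E).symm.continuous.comp (hu.continuous_fderiv (by norm_num))

theorem tsupport_gradient_subset (φ : E → ℝ) : tsupport (gradient φ) ⊆ tsupport φ := by
  refine (closure_mono fun x hx => ?_).trans (tsupport_fderiv_subset ℝ (f := φ))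
  rw [Function.mem_support] at hx ⊢
  exact fun h => hx (by simp [gradient, h])

theorem HasCompactSupport.gradient {φ : E → ℝ} (h : HasCompactSupport φ) :
    HasCompactSupport (gradient φ) :=
  h.mono' (subset_closure.trans (tsupport_gradient_subset φ))

theorem gradient_add_const (w : E → ℝ) (c : ℝ) :
    gradient (fun x => w x + c) = gradient w := by
  funext x; simp [gradient]

theorem gradient_const_mul (w : E → ℝ) (c : ℝ) :
    gradient (fun x => c * w x) = fun x => c • gradient w x := by
  funext x
  have : (fun x => c * w x) = c • w := rfl
  simp [gradient, this, fderiv_const_smul_field]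

variable [MeasurableSpace E] [BorelSpace E]

/-- `C¹` weak supersolutions of the `p`-Laplace equation. -/
structure IsSuper (p : ℝ) (Ω : Set E) (w : E → ℝ) : Prop where
  contDiffOn : ContDiffOn ℝ 1 w Ω
  nonneg : ∀ φ : E → ℝ, ContDiff ℝ 1 φ → HasCompactSupport φ → tsupport φ ⊆ Ω → (∀ x, 0 ≤ φ x) →
    0 ≤ ∫ x, ⟪flux p (gradient w x), gradient φ x⟫

/-- `C¹` weak solutions of the `p`-Laplace equation. -/
structure IsSol (p : ℝ) (Ω : Set E) (w : E → ℝ) : Prop where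
  contDiffOn : ContDiffOn ℝ 1 w Ω
  eq_zero : ∀ φ : E → ℝ, ContDiff ℝ 1 φ → HasCompactSupport φ → tsupport φ ⊆ Ω →
    ∫ x, ⟪flux p (gradient w x), gradient φ x⟫ = 0

theorem IsSol.isSuper {p : ℝ} {Ω : Set E} {w : E → ℝ} (h : IsSol p Ω w) : IsSuper p Ω w :=
  ⟨h.contDiffOn, fun φ h1 h2 h3 _ => (h.eq_zero φ h1 h2 h3).ge⟩

theorem IsSuper.mono {p : ℝ} {Ω Ω' : Set E} {w : E → ℝ} (h : IsSuper p Ω w) (hΩ : Ω' ⊆ Ω) :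
    IsSuper p Ω' w :=
  ⟨h.contDiffOn.mono hΩ, fun φ h1 h2 h3 => h.nonneg φ h1 h2 (h3.trans hΩ)⟩

theorem IsSol.mono {p : ℝ} {Ω Ω' : Set E} {w : E → ℝ} (h : IsSol p Ω w) (hΩ : Ω' ⊆ Ω) :
    IsSol p Ω' w :=
  ⟨h.contDiffOn.mono hΩ, fun φ h1 h2 h3 => h.eq_zero φ h1 h2 (h3.trans hΩ)⟩

theorem IsSuper.add_const {p : ℝ} {Ω : Set E} {w : E → ℝ} (h : IsSuper p Ω w) (c : ℝ) :
    IsSuper p Ω (fun x => w x + c) :=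
  ⟨h.contDiffOn.add contDiffOn_const, by simpa only [gradient_add_const] using h.nonneg⟩

theorem IsSol.add_const {p : ℝ} {Ω : Set E} {w : E → ℝ} (h : IsSol p Ω w) (c : ℝ) :
    IsSol p Ω (fun x => w x + c) :=
  ⟨h.contDiffOn.add contDiffOn_const, by simpa only [gradient_add_const] using h.eq_zero⟩

theorem isSol_const (p : ℝ) (Ω : Set E) (c : ℝ) : IsSol p Ω fun _ => c :=
  ⟨contDiffOn_const, by simp [flux_zero]⟩

theorem IsSol.const_mul {p : ℝ} {Ω : Set E} {w : E → ℝ} (h : IsSol p Ω w) (c : ℝ) :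
    IsSol p Ω (fun x => c * w x) := by
  refine ⟨contDiffOn_const.mul h.contDiffOn, fun φ h1 h2 h3 => ?_⟩
  have h0 := h.eq_zero φ h1 h2 h3
  rcases lt_trichotomy c 0 with hc | rfl | hc
  · have : ∀ ξ : E, flux p (c • ξ) = -((-c) ^ (p - 1) • flux p ξ) := fun ξ => by
      rw [← flux_smul p (neg_pos.2 hc), ← flux_neg]; simp
    simp only [gradient_const_mul, this, inner_neg_left, real_inner_smul_left]
    rw [integral_neg, integral_const_mul, h0]; simp
  · simp [flux_zero]
  · simp only [gradient_const_mul, flux_smul p hc, real_inner_smul_left]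
    rw [integral_const_mul, h0]; simp

theorem hasDerivAt_max_zero_sq (s : ℝ) :
    HasDerivAt (fun s : ℝ => max s 0 ^ 2) (2 * max s 0) s := by
  rcases lt_trichotomy s 0 with hs | rfl | hs
  · rw [max_eq_right hs.le]
    refine (hasDerivAt_const s (0 : ℝ)).congr_of_eventuallyEq ?_ |>.congr_deriv (by simp)
    filter_upwards [Iio_mem_nhds hs] with y hy
    simp [max_eq_right (le_of_lt (mem_Iio.1 hy))]
  · rw [hasDerivAt_iff_isLittleO_nhds_zero]
    simp only [zero_add, max_self]
    refine Asymptotics.IsBigO.trans_isLittleO (g := fun h : ℝ => h ^ 2) ?_ ?_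
    · refine Asymptotics.IsBigO.of_bound 1 (Eventually.of_forall fun h => ?_)
      simp only [mul_zero, smul_zero, sub_zero, one_mul, Real.norm_eq_abs, abs_pow, sq_abs]
      rcases le_total h 0 with h0 | h0
      · simp [max_eq_right h0]; positivity
      · simp [max_eq_left h0]
    · simpa using Asymptotics.isLittleO_pow_id (𝕜 := ℝ) (n := 2) (by norm_num)
  · rw [max_eq_left hs.le]
    refine ((hasDerivAt_pow 2 s).congr_of_eventuallyEq ?_).congr_deriv (by simp)
    filter_upwards [Ioi_mem_nhds hs] with y hy
    simp [max_eq_left (le_of_lt (mem_Ioi.1 hy))]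

theorem contDiff_max_zero_sq : ContDiff ℝ 1 fun s : ℝ => max s 0 ^ 2 := by
  rw [contDiff_one_iff_deriv]
  refine ⟨fun s => (hasDerivAt_max_zero_sq s).differentiableAt, ?_⟩
  rw [funext fun s => (hasDerivAt_max_zero_sq s).deriv]
  fun_prop

/-- Comparison principle. -/
theorem IsSol.le_of_lt_frontier [Nontrivial E] {p : ℝ} (hp : 2 ≤ p) {Ω K : Set E}
    (hΩ : IsOpen Ω) (hK : IsCompact K) (hKΩ : K ⊆ Ω) {u w : E → ℝ} (hu : IsSol p Ω u)
    (hw : IsSuper p Ω w) (h : ∀ x ∈ frontier K, u x < w x) : ∀ x ∈ K, u x ≤ w x := by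
  classical
  set φ : E → ℝ := (interior K).indicator fun x => max (u x - w x) 0 ^ 2 with hφ
  have hdiff : ∀ x ∈ Ω, ContDiffAt ℝ 1 (fun x => u x - w x) x := fun x hx =>
    (hu.contDiffOn.contDiffAt (hΩ.mem_nhds hx)).sub (hw.contDiffOn.contDiffAt (hΩ.mem_nhds hx))
  have hint : ∀ x ∈ interior K, φ =ᶠ[𝓝 x] fun x => max (u x - w x) 0 ^ 2 := fun x hx => by
    filter_upwards [isOpen_interior.mem_nhds hx] with y hy
    simp [hφ, hy]
  have hext : ∀ x ∉ interior K, φ =ᶠ[𝓝 x] fun _ => 0 := fun x hx => by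
    by_cases hxK : x ∈ K
    · have hxf : x ∈ frontier K := ⟨subset_closure hxK, hx⟩
      have hc : ContinuousAt (fun x => u x - w x) x := (hdiff x (hKΩ hxK)).continuousAt
      filter_upwards [hc.eventually_lt continuousAt_const (sub_neg.2 (h x hxf))] with y hy
      simp [hφ, indicator, max_eq_right hy.le]
    · filter_upwards [hK.isClosed.isOpen_compl.mem_nhds hxK] with y hy
      exact indicator_of_notMem (fun h => hy (interior_subset h)) _
  have hφ1 : ContDiff ℝ 1 φ := by
    refine contDiff_iff_contDiffAt.2 fun x => ?_
    by_cases hx : x ∈ interior K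
    · refine ContDiffAt.congr_of_eventuallyEq ?_ (hint x hx)
      exact contDiff_max_zero_sq.contDiffAt.comp x (hdiff x (hKΩ (interior_subset hx)))
    · exact contDiffAt_const.congr_of_eventuallyEq (hext x hx)
  have hsupp : tsupport φ ⊆ K :=
    closure_minimal ((support_indicator_subset).trans interior_subset) hK.isClosed
  have hcs : HasCompactSupport φ := hK.of_isClosed_subset (isClosed_tsupport φ) hsupp
  have hpos : ∀ x, 0 ≤ φ x := fun x => indicator_nonneg (fun _ _ => by positivity) x
  have hgrad : ∀ x ∈ interior K,
      gradient φ x = (2 * max (u x - w x) 0) • (gradient u x - gradient w x) := fun x hx => by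
    have hxΩ := hKΩ (interior_subset hx)
    have h1 : HasGradientAt u (gradient u x) x :=
      ((hu.contDiffOn.contDiffAt (hΩ.mem_nhds hxΩ)).differentiableAt one_ne_zero).hasGradientAt
    have h2 : HasGradientAt w (gradient w x) x :=
      ((hw.contDiffOn.contDiffAt (hΩ.mem_nhds hxΩ)).differentiableAt one_ne_zero).hasGradientAt
    rw [(hint x hx).gradient_eq]
    refine HasGradientAt.gradient ?_
    rw [hasGradientAt_iff_hasFDerivAt] at h1 h2 ⊢
    have := (hasDerivAt_max_zero_sq (u x - w x)).comp_hasFDerivAt x (h1.sub h2)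
    simpa [Function.comp_def] using this
  have hgrad0 : ∀ x ∉ interior K, gradient φ x = 0 := fun x hx => by
    rw [(hext x hx).gradient_eq]; simp
  have hcont : ∀ v : E → ℝ, ContDiffOn ℝ 1 v Ω →
      Continuous fun x => ⟪flux p (gradient v x), gradient φ x⟫ := fun v hv =>
    continuous_inner_of_tsupport_subset hΩ
      ((continuous_flux hp).comp_continuousOn (hv.continuousOn_gradient hΩ))
      hφ1.continuous_gradient (((tsupport_gradient_subset φ).trans hsupp).trans hKΩ)
  have hcompact : ∀ v : E → ℝ,
      HasCompactSupport fun x => ⟪flux p (gradient v x), gradient φ x⟫ := fun v =>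
    hcs.gradient.mono fun x hx => by
      rw [Function.mem_support] at hx ⊢
      exact fun h0 => hx (by rw [h0, inner_zero_right])
  have hI : ∫ x, (⟪flux p (gradient u x), gradient φ x⟫ - ⟪flux p (gradient w x), gradient φ x⟫)
      ≤ 0 := by
    rw [integral_sub ((hcont u hu.contDiffOn).integrable_of_hasCompactSupport (hcompact u))
      ((hcont w hw.contDiffOn).integrable_of_hasCompactSupport (hcompact w)),
      hu.eq_zero φ hφ1 hcs (hsupp.trans hKΩ)]
    linarith [hw.nonneg φ hφ1 hcs (hsupp.trans hKΩ) hpos]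
  have hnn : ∀ x, 0 ≤
      ⟪flux p (gradient u x), gradient φ x⟫ - ⟪flux p (gradient w x), gradient φ x⟫ := fun x => by
    by_cases hx : x ∈ interior K
    · rw [← inner_sub_left, hgrad x hx, real_inner_smul_right]
      exact mul_nonneg (by positivity) (inner_flux_sub_nonneg hp _ _)
    · simp [hgrad0 x hx]
  have hzero : ∀ x,
      ⟪flux p (gradient u x), gradient φ x⟫ - ⟪flux p (gradient w x), gradient φ x⟫ = 0 := by
    by_contra! hne
    obtain ⟨x, hx⟩ := hne
    have := ((hcont u hu.contDiffOn).sub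
      (hcont w hw.contDiffOn)).integral_pos_of_hasCompactSupport_nonneg_nonzero (μ := volume)
      ((hcompact u).sub (hcompact w)) hnn hx
    exact absurd hI (not_le.2 this)
  have hg0 : ∀ x, gradient φ x = 0 := fun x => by
    by_cases hx : x ∈ interior K
    · have h0 := hzero x
      rw [← inner_sub_left, hgrad x hx, real_inner_smul_right, mul_eq_zero] at h0
      rw [hgrad x hx]
      rcases h0 with h0 | h0
      · rw [h0, zero_smul]
      · rw [eq_of_inner_flux_sub_eq_zero hp h0, sub_self, smul_zero]
    · exact hgrad0 x hx
  have hconst : ∀ x y, φ x = φ y := by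
    refine is_const_of_fderiv_eq_zero (𝕜 := ℝ) (hφ1.differentiable one_ne_zero) fun x => ?_
    rw [← toDual_gradient, hg0, map_zero]
  have := NormedSpace.noncompactSpace ℝ E
  obtain ⟨z, hz⟩ : ∃ z, z ∉ K := by
    by_contra! hall
    exact noncompact_univ E (by rwa [← eq_univ_of_forall hall])
  intro x hx
  by_cases hxi : x ∈ interior K
  · have h1 : φ x = 0 := by
      rw [hconst x z]; exact indicator_of_notMem (fun h => hz (interior_subset h)) _
    simp only [hφ, indicator_of_mem hxi] at h1
    have h2 : max (u x - w x) 0 = 0 := by simpa using h1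
    linarith [le_max_left (u x - w x) 0]
  · exact (h x ⟨subset_closure hx, hxi⟩).le

end Comparison

section WeakForm

theorem continuous_mul_of_tsupport_subset {E : Type*} [TopologicalSpace E] {Ω : Set E} (hΩ : IsOpen Ω) {f g : E → ℝ}
    (hf : ContinuousOn f Ω) (hg : Continuous g) (hgΩ : tsupport g ⊆ Ω) :
    Continuous fun x => f x * g x := by
  refine continuous_iff_continuousAt.2 fun x => ?_
  by_cases hx : x ∈ Ω
  · exact (hf.continuousAt (hΩ.mem_nhds hx)).mul hg.continuousAt
  · have h0 : g =ᶠ[𝓝 x] 0 := notMem_tsupport_iff_eventuallyEq.1 fun h => hx (hgΩ h)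
    refine (continuousAt_const (y := (0 : ℝ))).congr ?_
    filter_upwards [h0] with y hy
    simp [hy]

variable {E : Type*} [NormedAddCommGroup E] [InnerProductSpace ℝ E] [FiniteDimensional ℝ E]
  [MeasurableSpace E] [BorelSpace E]

theorem exists_contDiff_gradient_dist_le {φ : E → ℝ} (hφ : ContDiff ℝ 1 φ)
    (hcs : HasCompactSupport φ) {ε δ : ℝ} (hε : 0 < ε) (hδ : 0 < δ) :
    ∃ ψ : E → ℝ, ContDiff ℝ (⊤ : ℕ∞) ψ ∧ tsupport ψ ⊆ cthickening δ (tsupport φ) ∧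
      ∀ x, ‖gradient φ x - gradient ψ x‖ ≤ ε := by
  have huc : UniformContinuous (fderiv ℝ φ) :=
    (hcs.fderiv ℝ).uniformContinuous_of_continuous (hφ.continuous_fderiv (by norm_num))
  obtain ⟨η, hη, hφη⟩ := Metric.uniformContinuous_iff.1 huc ε hε
  set r := min η δ with hr
  have hr0 : 0 < r := lt_min hη hδ
  let b : ContDiffBump (0 : E) := ⟨r / 2, r, by positivity, by linarith⟩
  set ψ : E → ℝ := convolution (b.normed volume) φ (ContinuousLinearMap.lsmul ℝ ℝ) volume with hψ
  have hfd : ∀ x, HasFDerivAt ψ (convolution (b.normed volume) (fderiv ℝ φ)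
      (ContinuousLinearMap.lsmul ℝ ℝ) volume x) x := fun x => by
    have := hcs.hasFDerivAt_convolution_right (ContinuousLinearMap.lsmul ℝ ℝ)
      (b.integrable_normed (μ := volume)).locallyIntegrable hφ x
    exact this
  refine ⟨ψ, ?_, ?_, fun x => ?_⟩
  · exact b.hasCompactSupport_normed.contDiff_convolution_left _ b.contDiff_normed
      hφ.continuous.locallyIntegrable
  · refine closure_minimal ?_ isClosed_cthickening
    refine (support_convolution_subset (ContinuousLinearMap.lsmul ℝ ℝ)).trans ?_
    rintro _ ⟨y, hy, z, hz, rfl⟩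
    rw [b.support_normed_eq] at hy
    refine mem_cthickening_of_dist_le _ z _ _ (subset_closure hz) ?_
    have : dist y 0 < r := hy
    simp only [dist_zero_right] at this
    simpa [dist_eq_norm] using (this.le.trans (min_le_right _ _))
  · have h1 : dist (convolution (b.normed volume) (fderiv ℝ φ)
        (ContinuousLinearMap.lsmul ℝ ℝ) volume x) (fderiv ℝ φ x) ≤ ε :=
      b.dist_normed_convolution_le
        (hφ.continuous_fderiv (by norm_num)).aestronglyMeasurable fun y hy =>
          (hφη (lt_of_lt_of_le (mem_ball.1 hy) (min_le_left _ _))).le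
    rw [← (hfd x).fderiv, dist_comm, dist_eq_norm] at h1
    simp only [gradient, ← map_sub, LinearIsometryEquiv.norm_map]
    exact h1

theorem integral_inner_gradient_eq_zero_of_smooth {Ω : Set E} (hΩ : IsOpen Ω) {X : E → E}
    (hX : ContinuousOn X Ω)
    (h : ∀ φ : E → ℝ, ContDiff ℝ (⊤ : ℕ∞) φ → HasCompactSupport φ → tsupport φ ⊆ Ω →
      ∫ x, ⟪X x, gradient φ x⟫ = 0)
    {φ : E → ℝ} (hφ : ContDiff ℝ 1 φ) (hcs : HasCompactSupport φ) (hφΩ : tsupport φ ⊆ Ω) :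
    ∫ x, ⟪X x, gradient φ x⟫ = 0 := by
  obtain ⟨δ, hδ, hδΩ⟩ := hcs.isCompact.exists_cthickening_subset_open hΩ hφΩ
  set K := cthickening δ (tsupport φ) with hKdef
  have hK : IsCompact K := hcs.isCompact.cthickening
  have hXK : IntegrableOn (fun x => ‖X x‖) K := (hX.mono hδΩ).norm.integrableOn_compact hK
  set C := ∫ x in K, ‖X x‖ with hC
  have hC0 : 0 ≤ C := integral_nonneg fun _ => norm_nonneg _
  have key : ∀ ε > 0, ‖∫ x, ⟪X x, gradient φ x⟫‖ ≤ ε * C := fun ε hε => by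
    obtain ⟨ψ, hψ1, hψ2, hψ3⟩ := exists_contDiff_gradient_dist_le hφ hcs hε hδ
    have hψcs : HasCompactSupport ψ := hK.of_isClosed_subset (isClosed_tsupport ψ) hψ2
    have hint : ∀ χ : E → ℝ, ContDiff ℝ 1 χ → HasCompactSupport χ → tsupport χ ⊆ Ω →
        Integrable fun x => ⟪X x, gradient χ x⟫ := fun χ h1 h2 h3 =>
      (continuous_inner_of_tsupport_subset hΩ hX h1.continuous_gradient
        ((tsupport_gradient_subset χ).trans h3)).integrable_of_hasCompactSupport
        (h2.gradient.mono fun x hx => by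
          rw [Function.mem_support] at hx ⊢
          exact fun h0 => hx (by rw [h0, inner_zero_right]))
    have hψ1' : ContDiff ℝ 1 ψ := hψ1.of_le (by exact_mod_cast le_top)
    have heq : ∫ x, ⟪X x, gradient φ x⟫ = ∫ x, ⟪X x, gradient φ x - gradient ψ x⟫ := by
      simp only [inner_sub_right]
      rw [integral_sub (hint φ hφ hcs hφΩ) (hint ψ hψ1' hψcs (hψ2.trans hδΩ)),
        h ψ hψ1 hψcs (hψ2.trans hδΩ), sub_zero]
    have hzero : ∀ χ : E → ℝ, tsupport χ ⊆ K → ∀ x ∉ K, gradient χ x = 0 := fun χ hχ x hx =>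
      image_eq_zero_of_notMem_tsupport fun h0 => hx (hχ (tsupport_gradient_subset χ h0))
    rw [heq, hC, ← integral_const_mul, ← integral_indicator hK.measurableSet]
    refine norm_integral_le_of_norm_le
      ((integrable_indicator_iff hK.measurableSet).2 (hXK.const_mul ε)) (Eventually.of_forall fun x => ?_)
    by_cases hx : x ∈ K
    · rw [indicator_of_mem hx, mul_comm]
      exact (norm_inner_le_norm _ _).trans
        (mul_le_mul_of_nonneg_left (hψ3 x) (norm_nonneg _))
    · rw [indicator_of_notMem hx, hzero φ (self_subset_cthickening _) x hx, hzero ψ hψ2 x hx]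
      simp
  rw [← norm_le_zero_iff]
  refine le_of_forall_pos_le_add fun ε hε => ?_
  refine (key (ε / (C + 1)) (by positivity)).trans ?_
  rw [zero_add, div_mul_eq_mul_div, div_le_iff₀ (by positivity)]
  nlinarith

/-- Integration by parts for a `C¹` vector field against a test function. -/
theorem integral_inner_gradient_eq_neg {Ω : Set E} (hΩ : IsOpen Ω) {X : E → E}
    {A : E → E →L[ℝ] E} (hX : ∀ x ∈ Ω, HasFDerivAt X (A x) x) (hA : ContinuousOn A Ω)
    {ι : Type*} [Fintype ι] (b : OrthonormalBasis ι ℝ E)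
    {φ : E → ℝ} (hφ : ContDiff ℝ 1 φ) (hcs : HasCompactSupport φ) (hφΩ : tsupport φ ⊆ Ω) :
    ∫ x, ⟪X x, gradient φ x⟫ = -∫ x, (∑ i, ⟪b i, A x (b i)⟫) * φ x := by
  have hXc : ContinuousOn X Ω := fun x hx => (hX x hx).continuousAt.continuousWithinAt
  have hi1 : ∀ i, Integrable fun x => ⟪b i, A x (b i)⟫ * φ x := fun i =>
    (continuous_mul_of_tsupport_subset hΩ (continuousOn_const.inner
      (hA.clm_apply continuousOn_const)) hφ.continuous hφΩ).integrable_of_hasCompactSupport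
      hcs.mul_left
  have hi2 : ∀ i, Integrable fun x => ⟪b i, X x⟫ * fderiv ℝ φ x (b i) := fun i =>
    (continuous_mul_of_tsupport_subset hΩ (continuousOn_const.inner hXc)
      ((hφ.continuous_fderiv (by norm_num)).clm_apply continuous_const)
      ((tsupport_fderiv_apply_subset ℝ (b i)).trans hφΩ)).integrable_of_hasCompactSupport
      ((hcs.fderiv_apply ℝ (b i)).mul_left)
  have hi3 : ∀ i, Integrable fun x => ⟪b i, X x⟫ * φ x := fun i =>
    (continuous_mul_of_tsupport_subset hΩ (continuousOn_const.inner hXc) hφ.continuous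
      hφΩ).integrable_of_hasCompactSupport hcs.mul_left
  have hparts : ∀ i, ∫ x, ⟪b i, X x⟫ * fderiv ℝ φ x (b i) = -∫ x, ⟪b i, A x (b i)⟫ * φ x :=
    fun i => integral_bilinear_hasFDerivAt_right_eq_neg_left_of_integrable (μ := volume)
      (f := fun x => ⟪b i, X x⟫) (f' := fun x => (innerSL ℝ (b i)).comp (A x))
      (g := φ) (g' := fderiv ℝ φ) (v := b i) (B := ContinuousLinearMap.mul ℝ ℝ)
      (hi1 i) (hi2 i) (hi3 i)
      (fun x hx => (innerSL ℝ (b i)).hasFDerivAt.comp x (hX x (hφΩ hx)))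
      (fun x _ => (hφ.differentiable one_ne_zero x).hasFDerivAt)
  have hsum : ∀ x, ⟪X x, gradient φ x⟫ = ∑ i, ⟪b i, X x⟫ * fderiv ℝ φ x (b i) := fun x => by
    rw [← b.sum_inner_mul_inner]
    refine Finset.sum_congr rfl fun i _ => ?_
    rw [real_inner_comm, real_inner_comm (gradient φ x), inner_gradient_left]
  simp only [hsum, Finset.sum_mul]
  rw [integral_finsetSum _ fun i _ => hi2 i, integral_finsetSum _ fun i _ => hi1 i,
    ← Finset.sum_neg_distrib]
  exact Finset.sum_congr rfl fun i _ => hparts i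

end WeakForm

section Barrier

variable {E : Type*} [NormedAddCommGroup E] [InnerProductSpace ℝ E]

theorem hasFDerivAt_norm_rpow_of_ne_zero (q : ℝ) {x : E} (hx : x ≠ 0) :
    HasFDerivAt (fun x : E => ‖x‖ ^ q) ((q * ‖x‖ ^ (q - 2)) • innerSL ℝ x) x := by
  have hx0 : 0 < ‖x‖ := norm_pos_iff.2 hx
  have h := ((hasStrictFDerivAt_norm_sq x).hasFDerivAt).rpow_const (p := q / 2)
    (Or.inl (by positivity))
  have hsq : ∀ y : E, ∀ r : ℝ, (‖y‖ ^ 2) ^ r = ‖y‖ ^ (2 * r) := fun y r => by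
    rw [← Real.rpow_natCast, ← Real.rpow_mul (norm_nonneg y)]; norm_num
  simp only [hsq] at h
  have e1 : 2 * (q / 2) = q := by ring
  have e2 : 2 * (q / 2 - 1) = q - 2 := by ring
  rw [e2] at h
  simp only [e1] at h
  refine h.congr_fderiv ?_
  ext v
  simp
  ring

theorem contDiffAt_norm_rpow_of_ne_zero (q : ℝ) {x : E} (hx : x ≠ 0) :
    ContDiffAt ℝ 1 (fun x : E => ‖x‖ ^ q) x :=
  (contDiffAt_norm ℝ hx).rpow_const_of_ne (norm_ne_zero_iff.2 hx)

theorem contDiffAt_flux (p : ℝ) {ξ : E} (hξ : ξ ≠ 0) : ContDiffAt ℝ 1 (flux p) ξ :=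
  (contDiffAt_norm_rpow_of_ne_zero (p - 2) hξ).smul contDiffAt_id

theorem hasFDerivAt_flux (p : ℝ) {ξ : E} (hξ : ξ ≠ 0) :
    HasFDerivAt (flux p) (‖ξ‖ ^ (p - 2) • ContinuousLinearMap.id ℝ E +
      (((p - 2) * ‖ξ‖ ^ (p - 4)) • innerSL ℝ ξ).smulRight ξ) ξ := by
  have h := (hasFDerivAt_norm_rpow_of_ne_zero (p - 2) hξ).smul (hasFDerivAt_id ξ)
  have e : p - 2 - 2 = p - 4 := by ring
  rw [e] at h
  exact h

variable [FiniteDimensional ℝ E] [MeasurableSpace E] [BorelSpace E]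

theorem integral_flux_eq {p : ℝ} {Ω : Set E} (hΩ : IsOpen Ω) {w : E → ℝ} {V : E → E}
    {B : E → E →L[ℝ] E} (hw : ∀ x ∈ Ω, HasGradientAt w (V x) x)
    (hV : ∀ x ∈ Ω, HasFDerivAt V (B x) x) (hVc : ContDiffOn ℝ 1 V Ω) (hV0 : ∀ x ∈ Ω, V x ≠ 0)
    {φ : E → ℝ} (hφ : ContDiff ℝ 1 φ) (hcs : HasCompactSupport φ) (hφΩ : tsupport φ ⊆ Ω) :
    ∫ x, ⟪flux p (gradient w x), gradient φ x⟫ =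
      -∫ x, ‖V x‖ ^ (p - 4) * (‖V x‖ ^ 2 * ∑ i, ⟪stdOrthonormalBasis ℝ E i,
        B x (stdOrthonormalBasis ℝ E i)⟫ + (p - 2) * ⟪V x, B x (V x)⟫) * φ x := by
  set b := stdOrthonormalBasis ℝ E
  set X : E → E := fun x => flux p (V x) with hX
  have h1 : ∀ x, ⟪flux p (gradient w x), gradient φ x⟫ = ⟪X x, gradient φ x⟫ := fun x => by
    by_cases hx : x ∈ Ω
    · rw [(hw x hx).gradient]
    · have : gradient φ x = 0 := image_eq_zero_of_notMem_tsupport fun h =>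
        hx (hφΩ (tsupport_gradient_subset φ h))
      simp [this]
  have hXc : ContDiffOn ℝ 1 X Ω := fun x hx =>
    (contDiffAt_flux p (hV0 x hx)).comp_contDiffWithinAt x (hVc x hx)
  have hXd : ∀ x ∈ Ω, HasFDerivAt X (fderiv ℝ X x) x := fun x hx =>
    ((hXc.contDiffAt (hΩ.mem_nhds hx)).differentiableAt one_ne_zero).hasFDerivAt
  simp only [h1]
  rw [integral_inner_gradient_eq_neg hΩ hXd (hXc.continuousOn_fderiv_of_isOpen hΩ le_rfl) b
    hφ hcs hφΩ]
  congr 1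
  refine integral_congr_ae (Eventually.of_forall fun x => ?_)
  by_cases hx : x ∈ Ω
  swap
  · have : φ x = 0 := image_eq_zero_of_notMem_tsupport fun h => hx (hφΩ h)
    simp [this]
  have hfd := ((hasFDerivAt_flux p (hV0 x hx)).comp x (hV x hx)).fderiv
  have hfd' : fderiv ℝ X x = _ := hfd
  have hn : 0 < ‖V x‖ := norm_pos_iff.2 (hV0 x hx)
  have hpow : ‖V x‖ ^ (p - 2) = ‖V x‖ ^ (p - 4) * ‖V x‖ ^ 2 := by
    rw [← Real.rpow_natCast, ← Real.rpow_add hn]; congr 1; push_cast; ring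
  have hsum : ∑ i, ⟪b i, V x⟫ * ⟪V x, B x (b i)⟫ = ⟪V x, B x (V x)⟫ := by
    conv_rhs => rw [← b.sum_repr' (V x)]
    simp only [map_sum, map_smul, inner_sum, real_inner_smul_right]
    rw [b.sum_repr' (V x)]
  beta_reduce
  congr 1
  rw [hfd']
  simp only [ContinuousLinearMap.coe_comp, Function.comp_apply, add_apply,
    smul_apply, ContinuousLinearMap.id_apply,
    ContinuousLinearMap.smulRight_apply, innerSL_apply_apply, inner_add_right,
    real_inner_smul_right, smul_eq_mul, Finset.sum_add_distrib, hpow]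
  rw [← hsum, mul_add, Finset.mul_sum, Finset.mul_sum, Finset.mul_sum, Finset.mul_sum]
  congr 1 <;> exact Finset.sum_congr rfl fun i _ => by ring

end Barrier

section Radial

variable {E : Type*} [NormedAddCommGroup E] [InnerProductSpace ℝ E]

theorem hasFDerivAt_comp_norm_sub_sq {g : ℝ → ℝ} {g' : ℝ} {c x : E}
    (hg : HasDerivAt g g' (‖x - c‖ ^ 2)) :
    HasFDerivAt (fun x => g (‖x - c‖ ^ 2)) ((2 * g') • innerSL ℝ (x - c)) x := by
  have h1 : HasFDerivAt (fun x : E => ‖x - c‖ ^ 2) (2 • innerSL ℝ (x - c)) x := by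
    have := ((hasFDerivAt_id x).sub_const c).norm_sq
    simpa using this
  have := hg.comp_hasFDerivAt x h1
  refine this.congr_fderiv ?_
  ext v; simp; ring

theorem hasFDerivAt_comp_norm_sub_sq_smul {g : ℝ → ℝ} {g' : ℝ} {c x : E}
    (hg : HasDerivAt g g' (‖x - c‖ ^ 2)) :
    HasFDerivAt (fun x => g (‖x - c‖ ^ 2) • (x - c)) (g (‖x - c‖ ^ 2) • ContinuousLinearMap.id ℝ E +
      ((2 * g') • innerSL ℝ (x - c)).smulRight (x - c)) x :=
  (hasFDerivAt_comp_norm_sub_sq hg).smul ((hasFDerivAt_id x).sub_const c)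

variable [FiniteDimensional ℝ E] [MeasurableSpace E] [BorelSpace E]

theorem hasGradientAt_comp_norm_sub_sq {g : ℝ → ℝ} {g' : ℝ} {c x : E}
    (hg : HasDerivAt g (g' / 2) (‖x - c‖ ^ 2)) :
    HasGradientAt (fun x => g (‖x - c‖ ^ 2)) (g' • (x - c)) x := by
  have := hasFDerivAt_comp_norm_sub_sq hg
  rw [hasGradientAt_iff_hasFDerivAt]
  refine this.congr_fderiv ?_
  ext v; simp; left; ring

theorem integral_flux_radial_add_radial {p : ℝ} {Ω : Set E} (hΩ : IsOpen Ω) {G H g h g' h' : ℝ → ℝ}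
    {c y : E}
    (hG : ∀ x ∈ Ω, HasDerivAt G (g (‖x - c‖ ^ 2) / 2) (‖x - c‖ ^ 2))
    (hH : ∀ x ∈ Ω, HasDerivAt H (h (‖x - y‖ ^ 2) / 2) (‖x - y‖ ^ 2))
    (hg : ∀ x ∈ Ω, HasDerivAt g (g' (‖x - c‖ ^ 2)) (‖x - c‖ ^ 2))
    (hh : ∀ x ∈ Ω, HasDerivAt h (h' (‖x - y‖ ^ 2)) (‖x - y‖ ^ 2))
    (hgc : ∀ x ∈ Ω, ContDiffAt ℝ 1 g (‖x - c‖ ^ 2)) (hhc : ∀ x ∈ Ω, ContDiffAt ℝ 1 h (‖x - y‖ ^ 2))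
    {V : E → E} (hV : V = fun x => g (‖x - c‖ ^ 2) • (x - c) + h (‖x - y‖ ^ 2) • (x - y))
    (hV0 : ∀ x ∈ Ω, V x ≠ 0) {φ : E → ℝ} (hφ : ContDiff ℝ 1 φ) (hcs : HasCompactSupport φ)
    (hφΩ : tsupport φ ⊆ Ω) :
    ∫ x, ⟪flux p (gradient (fun x => G (‖x - c‖ ^ 2) + H (‖x - y‖ ^ 2)) x), gradient φ x⟫ =
      -∫ x, ‖V x‖ ^ (p - 4) * (‖V x‖ ^ 2 *
        (Module.finrank ℝ E * (g (‖x - c‖ ^ 2) + h (‖x - y‖ ^ 2)) +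
          2 * g' (‖x - c‖ ^ 2) * ‖x - c‖ ^ 2 + 2 * h' (‖x - y‖ ^ 2) * ‖x - y‖ ^ 2) +
        (p - 2) * ((g (‖x - c‖ ^ 2) + h (‖x - y‖ ^ 2)) * ‖V x‖ ^ 2 +
          2 * g' (‖x - c‖ ^ 2) * ⟪V x, x - c⟫ ^ 2 + 2 * h' (‖x - y‖ ^ 2) * ⟪V x, x - y⟫ ^ 2)) *
        φ x := by
  have hw : ∀ x ∈ Ω, HasGradientAt (fun x => G (‖x - c‖ ^ 2) + H (‖x - y‖ ^ 2)) (V x) x := by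
    intro x hx
    rw [hV, hasGradientAt_iff_hasFDerivAt]
    have := (hasGradientAt_comp_norm_sub_sq (hG x hx)).hasFDerivAt.add
      (hasGradientAt_comp_norm_sub_sq (hH x hx)).hasFDerivAt
    refine this.congr_fderiv ?_
    simp
  have hVd : ∀ x ∈ Ω, HasFDerivAt V _ x := fun x hx => by
    rw [hV]
    exact (hasFDerivAt_comp_norm_sub_sq_smul (hg x hx)).add
      (hasFDerivAt_comp_norm_sub_sq_smul (hh x hx))
  have hVc : ContDiffOn ℝ 1 V Ω := fun x hx => by
    rw [hV]
    refine ContDiffAt.contDiffWithinAt (ContDiffAt.add ?_ ?_)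
    · exact ((hgc x hx).comp x ((contDiffAt_id.sub contDiffAt_const).norm_sq ℝ)).smul
        (contDiffAt_id.sub contDiffAt_const)
    · exact ((hhc x hx).comp x ((contDiffAt_id.sub contDiffAt_const).norm_sq ℝ)).smul
        (contDiffAt_id.sub contDiffAt_const)
  rw [integral_flux_eq hΩ hw hVd hVc hV0 hφ hcs hφΩ]
  congr 1
  refine integral_congr_ae (Eventually.of_forall fun x => ?_)
  beta_reduce
  set b := stdOrthonormalBasis ℝ E
  have hsum : ∀ z : E, ∑ i, ⟪b i, z⟫ * ⟪z, b i⟫ = ‖z‖ ^ 2 := fun z => by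
    rw [← real_inner_self_eq_norm_sq]
    conv_rhs => rw [← b.sum_repr' z]
    rw [inner_sum]
    simp only [real_inner_smul_right]
    rw [b.sum_repr' z]
  congr 2
  simp only [add_apply, smul_apply, ContinuousLinearMap.id_apply,
    ContinuousLinearMap.smulRight_apply, innerSL_apply_apply, inner_add_right,
    real_inner_smul_right, smul_eq_mul, Finset.sum_add_distrib, real_inner_self_eq_norm_sq,
    b.norm_eq_one]
  have e : ∀ (t : ℝ) (z : E), ∑ i, 2 * t * ⟪z, b i⟫ * ⟪b i, z⟫ = 2 * t * ‖z‖ ^ 2 := fun t z => by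
    rw [← hsum z, Finset.mul_sum]; exact Finset.sum_congr rfl fun i _ => by ring
  rw [e, e]
  simp only [one_pow, mul_one, Finset.sum_const, Finset.card_univ, Fintype.card_fin, nsmul_eq_mul,
    real_inner_comm (V x)]
  ring

end Radial

section PowerBarrier

variable {E : Type*} [NormedAddCommGroup E] [InnerProductSpace ℝ E]

theorem barrier_bracket_nonpos {p n k β e s q m γ μ : ℝ} (hp : 2 ≤ p) (hk : k * (p - 1) = p + n - 2)
    (hk0 : 0 ≤ k) (hk2 : k ≤ 2) (hβ : 0 < β) (he : 0 ≤ e) (hs : 0 < s) (hq : 0 ≤ q) (hqs : q ≤ s)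
    (hms : |m| ≤ s) (hγ : γ * s = -k * β) (hμ : n + p - 1 ≤ μ * q) (hμ0 : 0 ≤ μ)
    (heβ : 8 * p * e ≤ β) :
    (β ^ 2 * s + 2 * β * e * m + e ^ 2 * q) * (n * (β + e) + γ * s + -(μ * e) * q) +
      (p - 2) * ((β + e) * (β ^ 2 * s + 2 * β * e * m + e ^ 2 * q) + γ * (β * s + e * m) ^ 2 +
        -(μ * e) * (β * m + e * q) ^ 2) ≤ 0 := by
  have hγ' : γ = -k * β / s := by field_simp; linarith
  set W := β ^ 2 * s + 2 * β * e * m + e ^ 2 * q with hW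
  have h1 : γ * (β * s + e * m) ^ 2 = -k * β * (W - e ^ 2 * (q - m ^ 2 / s)) := by
    rw [hγ', hW]; field_simp; ring
  have hk' : k * p = p + n - 2 + k := by linarith
  have h2 : W * (n * (β + e) + γ * s + -(μ * e) * q) +
      (p - 2) * ((β + e) * W + γ * (β * s + e * m) ^ 2 + -(μ * e) * (β * m + e * q) ^ 2) =
      e * (W * (n + p - 2 - μ * q) + (p - 2) * k * β * e * (q - m ^ 2 / s)) -
      (p - 2) * (μ * e * (β * m + e * q) ^ 2) := by
    rw [h1, hγ]
    linear_combination (-β * W) * hk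
  rw [h2]
  have h8e : 16 * e ≤ β := by nlinarith
  have hm := neg_le_of_abs_le hms
  have hWge : β ^ 2 * s * (7 / 8) ≤ W := by
    have : β * e * (-s) ≤ β * e * m := mul_le_mul_of_nonneg_left hm (by positivity)
    have h3 : β * s * (16 * e) ≤ β * s * β := mul_le_mul_of_nonneg_left h8e (by positivity)
    have : 0 ≤ e ^ 2 * q := by positivity
    nlinarith
  have h4 : (p - 2) * k * β * e * (q - m ^ 2 / s) ≤ β ^ 2 * s / 4 := by
    have h5 : q - m ^ 2 / s ≤ s := by
      have : 0 ≤ m ^ 2 / s := by positivity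
      linarith
    have h6 : (p - 2) * k ≤ p * 2 := mul_le_mul (by linarith) hk2 hk0 (by linarith)
    have h7 : 0 ≤ (p - 2) * k := mul_nonneg (by linarith) hk0
    calc (p - 2) * k * β * e * (q - m ^ 2 / s) ≤ (p - 2) * k * β * e * s := by gcongr
      _ ≤ p * 2 * β * e * s := by gcongr
      _ = (8 * p * e) * (β * s) / 4 := by ring
      _ ≤ β * (β * s) / 4 := by gcongr
      _ = _ := by ring
  have h9 : W * (n + p - 2 - μ * q) ≤ -W := by
    have : 0 ≤ W := le_trans (by positivity) hWge
    nlinarith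
  have h10 : W * (n + p - 2 - μ * q) + (p - 2) * k * β * e * (q - m ^ 2 / s) ≤ 0 := by
    have : 0 ≤ β ^ 2 * s := by positivity
    linarith
  have h11 : 0 ≤ (p - 2) * (μ * e * (β * m + e * q) ^ 2) :=
    mul_nonneg (by linarith) (by positivity)
  have := mul_nonpos_of_nonneg_of_nonpos he h10
  linarith

variable [FiniteDimensional ℝ E] [MeasurableSpace E] [BorelSpace E]

theorem isSuper_norm_rpow_sub_exp {p α : ℝ} {Ω : Set E} (hΩ : IsOpen Ω) {c y : E} {κ l : ℝ}
    (hp : 2 ≤ p) (hα : α * (p - 1) = p - Module.finrank ℝ E) (hα0 : 0 < α) (hα1 : α ≤ 1)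
    (hκ : 0 ≤ κ) (hl : 0 ≤ l) (hc : c ∉ Ω)
    (h1 : ∀ x ∈ Ω, Module.finrank ℝ E + p - 1 ≤ 2 * l * ‖x - y‖ ^ 2)
    (h2 : ∀ x ∈ Ω, ‖x - y‖ ≤ ‖x - c‖)
    (h3 : ∀ x ∈ Ω, 8 * p * (2 * κ * l * Real.exp (-l * ‖x - y‖ ^ 2)) ≤ α * ‖x - c‖ ^ (α - 2)) :
    IsSuper p Ω fun x => ‖x - c‖ ^ α + -κ * Real.exp (-l * ‖x - y‖ ^ 2) := by
  have hne : ∀ x ∈ Ω, x - c ≠ 0 := fun x hx h => hc (sub_eq_zero.1 h ▸ hx)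
  have hs : ∀ x ∈ Ω, 0 < ‖x - c‖ ^ 2 := fun x hx => by have := norm_pos_iff.2 (hne x hx); positivity
  have hpow : ∀ (x : E) (r : ℝ), (‖x - c‖ ^ 2) ^ r = ‖x - c‖ ^ (2 * r) := fun x r => by
    rw [← Real.rpow_natCast, ← Real.rpow_mul (norm_nonneg _)]; norm_num
  refine ⟨?_, fun φ hφ hcs hφΩ hφ0 => ?_⟩
  · intro x hx
    refine ContDiffAt.contDiffWithinAt (ContDiffAt.add ?_ ?_)
    · exact ContDiffAt.comp x (contDiffAt_norm_rpow_of_ne_zero α (hne x hx))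
        (contDiffAt_id.sub contDiffAt_const)
    · exact contDiffAt_const.mul (((contDiffAt_const.mul
        ((contDiffAt_id.sub contDiffAt_const).norm_sq ℝ))).exp)
  set G : ℝ → ℝ := fun t => t ^ (α / 2)
  set H : ℝ → ℝ := fun t => -κ * Real.exp (-l * t)
  set g : ℝ → ℝ := fun t => α * t ^ (α / 2 - 1) with hg
  set g' : ℝ → ℝ := fun t => α * ((α / 2 - 1) * t ^ (α / 2 - 2)) with hg'
  set h : ℝ → ℝ := fun t => 2 * κ * l * Real.exp (-l * t) with hh
  set h' : ℝ → ℝ := fun t => -l * h t with hh'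
  have hexp : ∀ t : ℝ, HasDerivAt (fun t => Real.exp (-l * t)) (-l * Real.exp (-l * t)) t :=
    fun t => by
      have := ((hasDerivAt_id t).const_mul (-l)).exp
      simpa [mul_comm] using this
  have hw : (fun x => ‖x - c‖ ^ α + -κ * Real.exp (-l * ‖x - y‖ ^ 2)) =
      fun x => G (‖x - c‖ ^ 2) + H (‖x - y‖ ^ 2) := by
    ext x
    simp only [G, H, hpow]
    congr 2; ring
  set V : E → E := fun x => g (‖x - c‖ ^ 2) • (x - c) + h (‖x - y‖ ^ 2) • (x - y) with hV
  have hβ : ∀ x ∈ Ω, 0 < g (‖x - c‖ ^ 2) := fun x hx => mul_pos hα0 (Real.rpow_pos_of_pos (hs x hx) _)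
  have he : ∀ x, 0 ≤ h (‖x - y‖ ^ 2) := fun x => by positivity
  have heβ : ∀ x ∈ Ω, 8 * p * h (‖x - y‖ ^ 2) ≤ g (‖x - c‖ ^ 2) := fun x hx => by
    refine (h3 x hx).trans_eq ?_
    simp only [hg, hpow]
    congr 2; ring
  have hW : ∀ x, ‖V x‖ ^ 2 = g (‖x - c‖ ^ 2) ^ 2 * ‖x - c‖ ^ 2 +
      2 * g (‖x - c‖ ^ 2) * h (‖x - y‖ ^ 2) * ⟪x - c, x - y⟫ + h (‖x - y‖ ^ 2) ^ 2 * ‖x - y‖ ^ 2 :=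
    fun x => by
      rw [hV]
      simp only [norm_add_sq_real, norm_smul, mul_pow, Real.norm_eq_abs, sq_abs,
        real_inner_smul_left, real_inner_smul_right]
      ring
  have hm : ∀ x ∈ Ω, |⟪x - c, x - y⟫| ≤ ‖x - c‖ ^ 2 := fun x hx => by
    refine (abs_real_inner_le_norm _ _).trans ?_
    rw [sq]
    exact mul_le_mul_of_nonneg_left (h2 x hx) (norm_nonneg _)
  have hV0 : ∀ x ∈ Ω, V x ≠ 0 := fun x hx h0 => by
    have hlt : h (‖x - y‖ ^ 2) < g (‖x - c‖ ^ 2) := by nlinarith [heβ x hx, he x, hβ x hx]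
    have h4 : ‖g (‖x - c‖ ^ 2) • (x - c)‖ = ‖h (‖x - y‖ ^ 2) • (x - y)‖ := by
      rw [eq_neg_of_add_eq_zero_left h0, norm_neg]
    rw [norm_smul, norm_smul, Real.norm_of_nonneg (hβ x hx).le, Real.norm_of_nonneg (he x)] at h4
    have h5 : h (‖x - y‖ ^ 2) * ‖x - y‖ ≤ h (‖x - y‖ ^ 2) * ‖x - c‖ :=
      mul_le_mul_of_nonneg_left (h2 x hx) (he x)
    have h6 := mul_lt_mul_of_pos_right hlt (norm_pos_iff.2 (hne x hx))
    linarith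
  rw [hw, integral_flux_radial_add_radial hΩ (G := G) (H := H) (g := g) (h := h) (g' := g')
    (h' := h') ?_ ?_ ?_ ?_ ?_ ?_ hV hV0 hφ hcs hφΩ]
  · rw [← integral_neg]
    refine integral_nonneg fun x => ?_
    simp only [Pi.zero_apply]
    by_cases hx : x ∈ Ω
    swap
    · have : φ x = 0 := image_eq_zero_of_notMem_tsupport fun h => hx (hφΩ h)
      simp [this]
    refine neg_nonneg.2 (mul_nonpos_of_nonpos_of_nonneg
      (mul_nonpos_of_nonneg_of_nonpos (by positivity) ?_) (hφ0 x))
    have hVc : ⟪V x, x - c⟫ = g (‖x - c‖ ^ 2) * ‖x - c‖ ^ 2 + h (‖x - y‖ ^ 2) * ⟪x - c, x - y⟫ := by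
      simp only [hV, inner_add_left, real_inner_smul_left, real_inner_self_eq_norm_sq,
        real_inner_comm (x - c) (x - y)]
    have hVy : ⟪V x, x - y⟫ = g (‖x - c‖ ^ 2) * ⟪x - c, x - y⟫ + h (‖x - y‖ ^ 2) * ‖x - y‖ ^ 2 := by
      simp only [hV, inner_add_left, real_inner_smul_left, real_inner_self_eq_norm_sq]
    have hμ : 2 * h' (‖x - y‖ ^ 2) = -(2 * l * h (‖x - y‖ ^ 2)) := by simp only [hh']; ring
    rw [hW x, hVc, hVy, hμ]
    refine barrier_bracket_nonpos (k := 2 - α) hp (by linear_combination -hα) (by linarith)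
      (by linarith) (hβ x hx) (he x) (hs x hx) (sq_nonneg _)
      (by have := h2 x hx; gcongr) (hm x hx) ?_ (h1 x hx) (by positivity) (heβ x hx)
    have : (‖x - c‖ ^ 2) ^ (α / 2 - 1) = (‖x - c‖ ^ 2) ^ (α / 2 - 2) * ‖x - c‖ ^ 2 := by
      rw [← Real.rpow_add_one (hs x hx).ne']; ring_nf
    simp only [hg, hg', this]
    ring
  · intro x hx
    have := Real.hasDerivAt_rpow_const (p := α / 2) (Or.inl (hs x hx).ne')
    refine this.congr_deriv ?_
    simp only [hg]; ring
  · intro x _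
    refine ((hexp _).const_mul (-κ)).congr_deriv ?_
    simp only [hh]; ring
  · intro x hx
    have := (Real.hasDerivAt_rpow_const (p := α / 2 - 1) (Or.inl (hs x hx).ne')).const_mul α
    refine this.congr_deriv ?_
    simp only [hg']; ring_nf
  · intro x _
    refine ((hexp _).const_mul (2 * κ * l)).congr_deriv ?_
    simp only [hh', hh]; ring
  · intro x hx
    exact contDiffAt_const.mul (Real.contDiffAt_rpow_const_of_ne (hs x hx).ne')
  · intro x _
    exact contDiffAt_const.mul (contDiffAt_const.mul contDiffAt_id).exp

theorem isSol_norm_sub_rpow {p α : ℝ} (hα : α * (p - 1) = p - Module.finrank ℝ E) (hα0 : 0 < α)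
    (c : E) : IsSol p {c}ᶜ fun x => ‖x - c‖ ^ α := by
  have hne : ∀ x ∈ ({c}ᶜ : Set E), x - c ≠ 0 := fun x hx => sub_ne_zero.2 hx
  have hs : ∀ x ∈ ({c}ᶜ : Set E), 0 < ‖x - c‖ ^ 2 :=
    fun x hx => by have := norm_pos_iff.2 (hne x hx); positivity
  have hpow : ∀ (x : E) (r : ℝ), (‖x - c‖ ^ 2) ^ r = ‖x - c‖ ^ (2 * r) := fun x r => by
    rw [← Real.rpow_natCast, ← Real.rpow_mul (norm_nonneg _)]; norm_num
  refine ⟨fun x hx => (ContDiffAt.comp x (contDiffAt_norm_rpow_of_ne_zero α (hne x hx))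
        (contDiffAt_id.sub contDiffAt_const)).contDiffWithinAt, fun φ hφ hcs hφΩ => ?_⟩
  set G : ℝ → ℝ := fun t => t ^ (α / 2)
  set g : ℝ → ℝ := fun t => α * t ^ (α / 2 - 1) with hg
  set g' : ℝ → ℝ := fun t => α * ((α / 2 - 1) * t ^ (α / 2 - 2)) with hg'
  have hw : (fun x => ‖x - c‖ ^ α) =
      fun x => G (‖x - c‖ ^ 2) + (fun _ => 0) (‖x - c‖ ^ 2) := by
    ext x
    simp only [G, hpow, add_zero]
    congr 1; ring
  set V : E → E := fun x => g (‖x - c‖ ^ 2) • (x - c) + (fun _ => (0 : ℝ)) (‖x - c‖ ^ 2) • (x - c)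
    with hV
  have hβ : ∀ x ∈ ({c}ᶜ : Set E), 0 < g (‖x - c‖ ^ 2) :=
    fun x hx => mul_pos hα0 (Real.rpow_pos_of_pos (hs x hx) _)
  rw [hw, integral_flux_radial_add_radial isOpen_compl_singleton (G := G) (H := fun _ => 0) (g := g)
    (h := fun _ => 0) (g' := g') (h' := fun _ => 0) ?_ ?_ ?_ ?_ ?_ ?_ hV ?_ hφ hcs hφΩ]
  · rw [neg_eq_zero]
    refine integral_eq_zero_of_ae (Eventually.of_forall fun x => ?_)
    simp only [Pi.zero_apply]
    by_cases hx : x ∈ ({c}ᶜ : Set E)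
    swap
    · have : φ x = 0 := image_eq_zero_of_notMem_tsupport fun h => hx (hφΩ h)
      simp [this]
    have hW : ‖V x‖ ^ 2 = g (‖x - c‖ ^ 2) ^ 2 * ‖x - c‖ ^ 2 := by
      simp [hV, norm_smul, mul_pow]
    have hVc : ⟪V x, x - c⟫ = g (‖x - c‖ ^ 2) * ‖x - c‖ ^ 2 := by
      simp [hV, real_inner_smul_left]
    have : (‖x - c‖ ^ 2) ^ (α / 2 - 1) = (‖x - c‖ ^ 2) ^ (α / 2 - 2) * ‖x - c‖ ^ 2 := by
      rw [← Real.rpow_add_one (hs x hx).ne']; ring_nf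
    have hγ : 2 * g' (‖x - c‖ ^ 2) * ‖x - c‖ ^ 2 = (α - 2) * g (‖x - c‖ ^ 2) := by
      simp only [hg, hg', this]; ring
    rw [hW, hVc, hγ]
    refine mul_eq_zero_of_left (mul_eq_zero_of_right _ ?_) _
    linear_combination (p - 2) * g (‖x - c‖ ^ 2) ^ 2 * ‖x - c‖ ^ 2 * hγ +
      g (‖x - c‖ ^ 2) ^ 3 * ‖x - c‖ ^ 2 * hα
  · intro x hx
    have := Real.hasDerivAt_rpow_const (p := α / 2) (Or.inl (hs x hx).ne')
    refine this.congr_deriv ?_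
    simp only [hg]; ring
  · intro x _
    simpa using hasDerivAt_const _ (0 : ℝ)
  · intro x hx
    have := (Real.hasDerivAt_rpow_const (p := α / 2 - 1) (Or.inl (hs x hx).ne')).const_mul α
    refine this.congr_deriv ?_
    simp only [hg']; ring_nf
  · intro x _
    exact hasDerivAt_const _ (0 : ℝ)
  · intro x hx
    exact contDiffAt_const.mul (Real.contDiffAt_rpow_const_of_ne (hs x hx).ne')
  · intro x _
    exact contDiffAt_const
  · intro x hx
    simpa [hV, smul_eq_zero, (hβ x hx).ne'] using hne x hx

end PowerBarrier

section Squeeze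

variable {E : Type*} [NormedAddCommGroup E] [InnerProductSpace ℝ E]

theorem exists_unit_arc (hn : 2 ≤ Module.finrank ℝ E) {x y : E} {R : ℝ}
    (hx : ‖x‖ = R) (hy : ‖y‖ = R) :
    ∃ (θ : ℝ) (e₁ e₂ : E), 0 ≤ θ ∧ θ ≤ Real.pi ∧ ‖e₁‖ = 1 ∧ ‖e₂‖ = 1 ∧ ⟪e₁, e₂⟫ = 0 ∧
      x = R • e₁ ∧ y = R • (Real.cos θ • e₁ + Real.sin θ • e₂) := by
  have hR : 0 ≤ R := hx ▸ norm_nonneg x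
  have : FiniteDimensional ℝ E := Module.finite_of_finrank_pos (by omega)
  have : Nontrivial E := Module.nontrivial_of_finrank_pos (R := ℝ) (by omega)
  have perp : ∀ e : E, ∃ f : E, ‖f‖ = 1 ∧ ⟪e, f⟫ = 0 := fun e => by
    have h1 := Submodule.finrank_add_finrank_orthogonal (ℝ ∙ e)
    have h2 := finrank_span_le_card (R := ℝ) ({e} : Set E)
    simp only [Set.toFinset_singleton, Finset.card_singleton] at h2
    have h3 : 0 < Module.finrank ℝ (ℝ ∙ e)ᗮ := by omega
    have := Module.nontrivial_of_finrank_pos h3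
    obtain ⟨⟨f, hf⟩, hf0⟩ := exists_ne (0 : (ℝ ∙ e)ᗮ)
    have hf0' : f ≠ 0 := fun h => hf0 (by simp [h])
    refine ⟨‖f‖⁻¹ • f, norm_smul_inv_norm hf0', ?_⟩
    rw [real_inner_smul_right, Submodule.mem_orthogonal_singleton_iff_inner_right.1 hf, mul_zero]
  rcases hR.eq_or_lt with rfl | hR0
  · obtain ⟨e, he⟩ := exists_norm_eq E zero_le_one
    obtain ⟨f, hf, hef⟩ := perp e
    exact ⟨0, e, f, le_rfl, Real.pi_pos.le, he, hf, hef, by simpa using hx, by simpa using hy⟩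
  obtain ⟨e, e_def⟩ : ∃ e, e = R⁻¹ • x := ⟨_, rfl⟩
  obtain ⟨g, g_def⟩ : ∃ g, g = R⁻¹ • y := ⟨_, rfl⟩
  have he : ‖e‖ = 1 := by simp [e_def, norm_smul, hx, abs_of_pos hR0, hR0.ne']
  have hg : ‖g‖ = 1 := by simp [g_def, norm_smul, hy, abs_of_pos hR0, hR0.ne']
  have hxe : x = R • e := by simp [e_def, smul_smul, hR0.ne']
  have hyg : y = R • g := by simp [g_def, smul_smul, hR0.ne']
  have hb := abs_le.1 ((abs_real_inner_le_norm e g).trans_eq (by rw [he, hg, one_mul]))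
  set θ := Real.arccos ⟪e, g⟫
  have hcos : Real.cos θ = ⟪e, g⟫ := Real.cos_arccos hb.1 hb.2
  have hsin : 0 ≤ Real.sin θ := Real.sin_nonneg_of_nonneg_of_le_pi (Real.arccos_nonneg _)
    (Real.arccos_le_pi _)
  set w := g - Real.cos θ • e with hw
  have hwn : ‖w‖ = Real.sin θ := by
    rw [← sq_eq_sq₀ (norm_nonneg _) hsin, Real.sin_sq, hw, norm_sub_sq_real, norm_smul, he, hg,
      real_inner_smul_right, real_inner_comm, hcos]
    simp
    ring
  have hwe : ⟪e, w⟫ = 0 := by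
    rw [hw, inner_sub_right, real_inner_smul_right, real_inner_self_eq_norm_sq, he, hcos]; ring
  by_cases h0 : w = 0
  · obtain ⟨f, hf, hef⟩ := perp e
    refine ⟨θ, e, f, Real.arccos_nonneg _, Real.arccos_le_pi _, he, hf, hef, hxe, ?_⟩
    rw [← hwn, h0, norm_zero, zero_smul, add_zero, ← sub_eq_zero.1 (hw.symm.trans h0), ← hyg]
  · refine ⟨θ, e, ‖w‖⁻¹ • w, Real.arccos_nonneg _, Real.arccos_le_pi _, he, norm_smul_inv_norm h0,
      by rw [real_inner_smul_right, hwe, mul_zero], hxe, ?_⟩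
    rw [← hwn, smul_smul ‖w‖, mul_inv_cancel₀ (norm_ne_zero_iff.2 h0), one_smul, hw,
      add_sub_cancel, ← hyg]

theorem exists_chain_sphere (hn : 2 ≤ Module.finrank ℝ E) {x y : E} {R : ℝ}
    (hx : ‖x‖ = R) (hy : ‖y‖ = R) {N : ℕ} (hN : 0 < N) :
    ∃ c : ℕ → E, c 0 = x ∧ c N = y ∧ (∀ k, ‖c k‖ = R) ∧
      ∀ k, ‖c (k + 1) - c k‖ ≤ 4 * R / N := by
  have hR : 0 ≤ R := hx ▸ norm_nonneg x
  obtain ⟨θ, e, f, h0, hπ, he, hf, hef, rfl, rfl⟩ := exists_unit_arc hn hx hy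
  have hN' : (0 : ℝ) < N := Nat.cast_pos.2 hN
  have key : ∀ a b : ℝ, ‖a • e + b • f‖ ^ 2 = a ^ 2 + b ^ 2 := fun a b => by
    rw [norm_add_sq_real, norm_smul, norm_smul, he, hf, real_inner_smul_left,
      real_inner_smul_right, hef]
    simp
  refine ⟨fun k => R • (Real.cos (k * θ / N) • e + Real.sin (k * θ / N) • f), by simp, ?_,
    fun k => ?_, fun k => ?_⟩
  · simp [hN'.ne']
  · have : ‖Real.cos (k * θ / N) • e + Real.sin (k * θ / N) • f‖ = 1 := by
      rw [← sq_eq_sq₀ (norm_nonneg _) zero_le_one, key]; simp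
    rw [norm_smul, this, Real.norm_of_nonneg hR, mul_one]
  · have hstep : ∀ a b : ℝ, ‖Real.cos a • e + Real.sin a • f - (Real.cos b • e + Real.sin b • f)‖ ≤
        |a - b| := fun a b => by
      rw [add_sub_add_comm, ← sub_smul, ← sub_smul]
      refine abs_le_of_sq_le_sq' ?_ (abs_nonneg _) |>.2
      rw [key, sq_abs]
      have h1 := Real.one_sub_sq_div_two_le_cos (x := a - b)
      rw [Real.cos_sub] at h1
      nlinarith [Real.sin_sq_add_cos_sq a, Real.sin_sq_add_cos_sq b]
    rw [← smul_sub, norm_smul, Real.norm_of_nonneg hR]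
    calc R * _ ≤ R * |((k + 1 : ℕ) : ℝ) * θ / N - k * θ / N| := by gcongr; exact hstep _ _
      _ = R * (θ / N) := by
        congr 1
        rw [abs_of_nonneg] <;> push_cast <;> ring_nf <;> positivity
      _ ≤ R * (4 / N) := by gcongr; linarith [Real.pi_le_four]
      _ = 4 * R / N := by ring

variable [FiniteDimensional ℝ E] [MeasurableSpace E] [BorelSpace E]

theorem isOpen_norm_gt (R : ℝ) : IsOpen {x : E | R < ‖x‖} := isOpen_lt continuous_const continuous_norm

theorem IsSol.le_of_le_frontier [Nontrivial E] {p : ℝ} (hp : 2 ≤ p) {Ω K : Set E}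
    (hΩ : IsOpen Ω) (hK : IsCompact K) (hKΩ : K ⊆ Ω) {u w : E → ℝ} (hu : IsSol p Ω u)
    (hw : IsSuper p Ω w) (h : ∀ x ∈ frontier K, u x ≤ w x) : ∀ x ∈ K, u x ≤ w x := fun x hx =>
  le_of_forall_pos_le_add fun ε hε => hu.le_of_lt_frontier hp hΩ hK hKΩ (hw.add_const ε)
    (fun y hy => by linarith [h y hy]) x hx

theorem frontier_annulus_subset (c : E) (a b : ℝ) :
    frontier {x : E | a ≤ ‖x - c‖ ∧ ‖x - c‖ ≤ b} ⊆ {x | ‖x - c‖ = a ∨ ‖x - c‖ = b} := by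
  have hcont : Continuous fun x : E => ‖x - c‖ := by fun_prop
  have hcl : IsClosed {x : E | a ≤ ‖x - c‖ ∧ ‖x - c‖ ≤ b} :=
    (isClosed_le continuous_const hcont).inter (isClosed_le hcont continuous_const)
  have hop : IsOpen {x : E | a < ‖x - c‖ ∧ ‖x - c‖ < b} :=
    (isOpen_lt continuous_const hcont).inter (isOpen_lt hcont continuous_const)
  have hsub := interior_maximal (s := {x : E | a ≤ ‖x - c‖ ∧ ‖x - c‖ ≤ b})
    (fun x (hx : a < ‖x - c‖ ∧ ‖x - c‖ < b) => ⟨hx.1.le, hx.2.le⟩) hop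
  intro x hx
  rw [hcl.frontier_eq] at hx
  by_contra! hne
  rw [mem_setOf_eq, not_or] at hne
  exact hx.2 (hsub ⟨lt_of_le_of_ne hx.1.1 (Ne.symm hne.1), lt_of_le_of_ne hx.1.2 hne.2⟩)

theorem isCompact_annulus (c : E) (a b : ℝ) : IsCompact {x : E | a ≤ ‖x - c‖ ∧ ‖x - c‖ ≤ b} := by
  have hcont : Continuous fun x : E => ‖x - c‖ := by fun_prop
  refine (isCompact_closedBall c b).of_isClosed_subset
    ((isClosed_le continuous_const hcont).inter (isClosed_le hcont continuous_const)) ?_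
  intro x hx
  simpa [dist_eq_norm] using hx.2

theorem IsSol.le_of_le_annulus [Nontrivial E] {p : ℝ} (hp : 2 ≤ p) {Ω : Set E}
    (hΩ : IsOpen Ω) {c : E} {a b : ℝ} (hΩ' : ∀ x, a ≤ ‖x - c‖ → ‖x - c‖ ≤ b → x ∈ Ω) {u w : E → ℝ}
    (hu : IsSol p Ω u) (hw : IsSuper p Ω w) (ha : ∀ x, ‖x - c‖ = a → u x ≤ w x)
    (hb : ∀ x, ‖x - c‖ = b → u x ≤ w x) {x : E} (hax : a ≤ ‖x - c‖) (hxb : ‖x - c‖ ≤ b) :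
    u x ≤ w x :=
  hu.le_of_le_frontier hp hΩ (isCompact_annulus c a b) (fun x hx => hΩ' x hx.1 hx.2) hw
    (fun y hy => (frontier_annulus_subset c a b hy).elim (ha y) (hb y)) x ⟨hax, hxb⟩

theorem IsSol.le_of_frequently_le_sphere [Nontrivial E] {p : ℝ} (hp : 2 ≤ p) {R₀ a : ℝ}
    (ha : R₀ < a) {u w : E → ℝ} (hu : IsSol p {x | R₀ < ‖x‖} u) (hw : IsSol p {x | R₀ < ‖x‖} w)
    (h1 : ∀ x, ‖x‖ = a → u x ≤ w x) (h : ∃ᶠ R in atTop, ∀ x, ‖x‖ = R → u x ≤ w x) {x : E}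
    (hx : a ≤ ‖x‖) : u x ≤ w x := by
  obtain ⟨R, hR, hxR⟩ := (h.and_eventually (eventually_ge_atTop ‖x‖)).exists
  have := hu.le_of_le_annulus (c := 0) hp (isOpen_norm_gt R₀)
    (fun y hy _ => by rw [sub_zero] at hy; exact ha.trans_le hy) hw.isSuper (a := a) (b := R)
    (by simpa using h1) (by simpa using hR) (x := x)
  rw [sub_zero] at this
  exact this hx hxR

theorem IsSol.eventually_le_of_frequently_le_sphere [Nontrivial E] {p : ℝ} (hp : 2 ≤ p) {R₀ : ℝ}
    {u w : E → ℝ} (hu : IsSol p {x | R₀ < ‖x‖} u) (hw : IsSol p {x | R₀ < ‖x‖} w)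
    (h : ∃ᶠ R in atTop, ∀ x, ‖x‖ = R → u x ≤ w x) :
    ∀ᶠ x in Bornology.cobounded E, u x ≤ w x := by
  obtain ⟨a, ha, haR⟩ := (h.and_eventually (eventually_gt_atTop R₀)).exists
  filter_upwards [tendsto_norm_cobounded_atTop.eventually (eventually_ge_atTop a)] with x hx
  exact hu.le_of_frequently_le_sphere hp haR hw ha h hx

end Squeeze

section Supercritical

variable {E : Type*} [NormedAddCommGroup E] [InnerProductSpace ℝ E] [FiniteDimensional ℝ E]
  [MeasurableSpace E] [BorelSpace E]

theorem isSol_affine_norm_rpow {p α : ℝ} (hα : α * (p - 1) = p - Module.finrank ℝ E) (hα0 : 0 < α)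
    {R : ℝ} (hR : 0 ≤ R) (A B : ℝ) : IsSol p {x : E | R < ‖x‖} fun x => A * ‖x‖ ^ α + B := by
  have := ((isSol_norm_sub_rpow hα hα0 (0 : E)).const_mul A).add_const B
  simp only [sub_zero] at this
  exact this.mono fun x hx h => by
    rw [mem_singleton_iff] at h
    subst h
    have : R < ‖(0 : E)‖ := hx
    rw [norm_zero] at this
    linarith

theorem IsSol.cone_le [Nontrivial E] {p α : ℝ} (hp : 2 ≤ p)
    (hα : α * (p - 1) = p - Module.finrank ℝ E) (hα0 : 0 < α) {Ω : Set E} (hΩ : IsOpen Ω) {y : E}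
    {r : ℝ} (hr : 0 < r) (hB : closedBall y r ⊆ Ω) {u : E → ℝ} (hu : IsSol p Ω u)
    (h0 : ∀ x, ‖x - y‖ = r → 0 ≤ u x) (hy : 0 < u y) {x : E} (hx : ‖x - y‖ ≤ r) :
    u y * (1 - (‖x - y‖ / r) ^ α) ≤ u x := by
  rcases eq_or_ne x y with rfl | hxy
  · simp [Real.zero_rpow hα0.ne']
  have hxy0 : 0 < ‖x - y‖ := norm_pos_iff.2 (sub_ne_zero.2 hxy)
  have hyΩ : y ∈ Ω := hB (mem_closedBall_self hr.le)
  have ht : 0 ≤ 1 - (‖x - y‖ / r) ^ α :=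
    sub_nonneg.2 (Real.rpow_le_one (by positivity) ((div_le_one hr).2 hx) hα0.le)
  have key : ∀ θ < u y, 0 ≤ θ → θ * (1 - (‖x - y‖ / r) ^ α) ≤ u x := by
    intro θ hθ hθ0
    have hc : ContinuousAt u y := hu.contDiffOn.continuousOn.continuousAt (hΩ.mem_nhds hyΩ)
    obtain ⟨s₀, hs₀, hs⟩ := Metric.eventually_nhds_iff.1 (hc.eventually (lt_mem_nhds hθ))
    set s := min (s₀ / 2) ‖x - y‖ with hsd
    have hs0 : 0 < s := lt_min (by linarith) hxy0
    have hw := ((isSol_norm_sub_rpow hα hα0 y).const_mul (-(θ * (r ^ α)⁻¹))).add_const θ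
    have hweq : ∀ z, -(θ * (r ^ α)⁻¹) * ‖z - y‖ ^ α + θ = θ * (1 - (‖z - y‖ / r) ^ α) := fun z => by
      rw [Real.div_rpow (norm_nonneg _) hr.le, div_eq_mul_inv]; ring
    simp only [hweq] at hw
    refine IsSol.le_of_le_annulus hp (hΩ.inter isOpen_compl_singleton) (c := y) (a := s) (b := r) ?_
      (hw.mono inter_subset_right) (hu.isSuper.mono inter_subset_left) ?_ ?_ (min_le_right _ _) hx
    · refine fun z hz hzr => ⟨hB (by simpa [dist_eq_norm] using hzr), fun h => ?_⟩
      rw [mem_singleton_iff.1 h, sub_self, norm_zero] at hz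
      linarith
    · intro z hz
      have h1 : θ < u z := hs (by
        rw [dist_eq_norm, hz]
        exact (min_le_left _ _).trans_lt (by linarith))
      refine le_trans ?_ h1.le
      have : 0 ≤ (‖z - y‖ / r) ^ α := by positivity
      nlinarith
    · intro z hz
      rw [hz, div_self hr.ne', Real.one_rpow, sub_self, mul_zero]
      exact h0 z hz
  have htd : Tendsto (fun θ => θ * (1 - (‖x - y‖ / r) ^ α)) (𝓝[<] (u y))
      (𝓝 (u y * (1 - (‖x - y‖ / r) ^ α))) :=
      (tendsto_nhdsWithin_of_tendsto_nhds tendsto_id).mul_const _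
  refine le_of_tendsto htd ?_
  filter_upwards [Ioo_mem_nhdsLT hy] with θ hθ using key θ hθ.2 hθ.1.le

end Supercritical

section SupercriticalLimits

variable {E : Type*} [NormedAddCommGroup E] [InnerProductSpace ℝ E] [FiniteDimensional ℝ E]
  [MeasurableSpace E] [BorelSpace E]

theorem exists_harnack_sphere (hn : 2 ≤ Module.finrank ℝ E) {p α : ℝ} (hp : 2 ≤ p)
    (hα : α * (p - 1) = p - Module.finrank ℝ E) (hα0 : 0 < α) :
    ∃ C : ℝ, 1 ≤ C ∧ ∀ (R₁ : ℝ) (u : E → ℝ), 0 ≤ R₁ → IsSol p {x | R₁ < ‖x‖} u →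
      (∀ x, R₁ < ‖x‖ → 0 < u x) → ∀ x y : E, 0 < ‖x‖ → 2 * R₁ ≤ ‖x‖ → ‖y‖ = ‖x‖ →
      u y ≤ C * u x := by
  have : Nontrivial E := Module.nontrivial_of_finrank_pos (R := ℝ) (by omega)
  set c₀ : ℝ := 1 - (1 / 4) ^ α with hc₀
  have h1 : (1 / 4 : ℝ) ^ α < 1 := Real.rpow_lt_one (by norm_num) (by norm_num) hα0
  have h2 : (0 : ℝ) < (1 / 4 : ℝ) ^ α := by positivity
  have hc0 : 0 < c₀ := by linarith
  have hc1 : c₀ ≤ 1 := by linarith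
  refine ⟨(c₀ ^ 64)⁻¹, (one_le_inv₀ (by positivity)).2 (pow_le_one₀ hc0.le hc1),
    fun R₁ u hR₁ hu hpos x y hx0 hx hyx => ?_⟩
  obtain ⟨c, hc0', hcN, hcR, hstep⟩ := exists_chain_sphere hn hyx rfl (N := 64) (by norm_num)
  have hk : ∀ k, u (c 0) * c₀ ^ k ≤ u (c k) := by
    intro k
    induction k with
    | zero => simp
    | succ k ih =>
      have hball : closedBall (c k) (‖x‖ / 4) ⊆ {z | R₁ < ‖z‖} := fun z hz => by
        rw [mem_closedBall, dist_eq_norm] at hz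
        have := norm_sub_norm_le (c k) z
        rw [norm_sub_rev, hcR k] at this
        show R₁ < ‖z‖
        linarith
      have hpk : 0 < u (c k) := hpos _ (by rw [hcR k]; linarith)
      have hs : ‖c (k + 1) - c k‖ ≤ ‖x‖ / 4 / 4 := (hstep k).trans (by push_cast; linarith)
      have h3 := hu.cone_le hp hα hα0 (isOpen_norm_gt R₁) (by positivity) hball
        (fun z hz => (hpos z (hball (by simpa [dist_eq_norm] using hz.le))).le) hpk
        (x := c (k + 1)) (by linarith)
      have h4 : c₀ ≤ 1 - (‖c (k + 1) - c k‖ / (‖x‖ / 4)) ^ α := by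
        rw [hc₀]
        refine sub_le_sub_left (Real.rpow_le_rpow (by positivity) ?_ hα0.le) _
        rw [div_le_iff₀ (by positivity)]
        linarith
      have h5 : u (c k) * c₀ ≤ u (c (k + 1)) := (mul_le_mul_of_nonneg_left h4 hpk.le).trans h3
      calc u (c 0) * c₀ ^ (k + 1) = u (c 0) * c₀ ^ k * c₀ := by ring
        _ ≤ u (c k) * c₀ := by gcongr
        _ ≤ _ := h5
  have h7 := hk 64
  rw [hc0', hcN] at h7
  rwa [inv_mul_eq_div, le_div_iff₀ (by positivity)]

theorem exists_pos_eventually_le (hn : 2 ≤ Module.finrank ℝ E) {p α : ℝ} (hp : 2 ≤ p)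
    (hα : α * (p - 1) = p - Module.finrank ℝ E) (hα0 : 0 < α) {R₀ : ℝ} (hR₀ : 0 ≤ R₀) {u : E → ℝ}
    (hu : IsSol p {x | R₀ < ‖x‖} u) (hpos : ∀ x, R₀ < ‖x‖ → 0 < u x) :
    ∃ μ > 0, ∀ᶠ x in Bornology.cobounded E, μ ≤ u x := by
  have : Nontrivial E := Module.nontrivial_of_finrank_pos (R := ℝ) (by omega)
  have hsub : sphere (0 : E) (R₀ + 1) ⊆ {x | R₀ < ‖x‖} := fun x hx => by
    rw [mem_sphere_zero_iff_norm] at hx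
    show R₀ < ‖x‖
    linarith
  obtain ⟨μ, hμ, hμu⟩ := (isCompact_sphere (0 : E) (R₀ + 1)).exists_forall_le'
    (hu.contDiffOn.continuousOn.mono hsub) (a := 0) fun x hx => hpos x (hsub hx)
  refine ⟨μ, hμ, ?_⟩
  filter_upwards [tendsto_norm_cobounded_atTop.eventually (eventually_ge_atTop (R₀ + 1))] with x hx
  have hx0 : 0 < ‖x‖ ^ α := Real.rpow_pos_of_pos (by linarith) _
  refine le_of_forall_pos_le_add fun ε hε => ?_
  have hw := isSol_affine_norm_rpow hα hα0 hR₀ (-(ε / ‖x‖ ^ α)) μ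
  have := hw.le_of_frequently_le_sphere hp (by linarith) hu (a := R₀ + 1) (fun z hz => ?_) ?_ hx
  · rw [neg_mul, div_mul_cancel₀ _ hx0.ne'] at this
    linarith
  · have := hμu z (mem_sphere_zero_iff_norm.2 hz)
    have : 0 ≤ ε / ‖x‖ ^ α * ‖z‖ ^ α := by positivity
    linarith
  · have h1 := (tendsto_rpow_atTop hα0).eventually_ge_atTop (μ * (‖x‖ ^ α / ε))
    refine (h1.and (eventually_gt_atTop R₀)).frequently.mono fun R hR z hz => ?_
    have h2 : ε / ‖x‖ ^ α * (μ * (‖x‖ ^ α / ε)) ≤ ε / ‖x‖ ^ α * ‖z‖ ^ α := by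
      rw [hz]; gcongr; exact hR.1
    have h3 : ε / ‖x‖ ^ α * (μ * (‖x‖ ^ α / ε)) = μ := by field_simp
    have := hpos z (by rw [hz]; exact hR.2)
    linarith

theorem frequently_sphere_of_frequently {P : E → Prop} (h : ∃ᶠ x in Bornology.cobounded E, P x)
    (R₁ : ℝ) : ∃ᶠ R in atTop, R₁ < R ∧ ∃ x, ‖x‖ = R ∧ P x :=
  tendsto_norm_cobounded_atTop.frequently
    ((h.and_eventually (tendsto_norm_cobounded_atTop.eventually (eventually_gt_atTop R₁))).mono
      fun x hx => ⟨hx.2, x, rfl, hx.1⟩)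

theorem tendsto_atTop_or_exists_tendsto (hn : 2 ≤ Module.finrank ℝ E) {p α : ℝ} (hp : 2 ≤ p)
    (hα : α * (p - 1) = p - Module.finrank ℝ E) (hα0 : 0 < α) {R₀ : ℝ} (hR₀ : 0 ≤ R₀) {u : E → ℝ}
    (hu : IsSol p {x | R₀ < ‖x‖} u) (hpos : ∀ x, R₀ < ‖x‖ → 0 < u x) :
    Tendsto u (Bornology.cobounded E) atTop ∨
      ∃ m > 0, Tendsto u (Bornology.cobounded E) (𝓝 m) := by
  have : Nontrivial E := Module.nontrivial_of_finrank_pos (R := ℝ) (by omega)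
  rw [or_iff_not_imp_left]
  intro hnt
  simp only [Filter.tendsto_atTop, not_forall, not_eventually, not_le] at hnt
  obtain ⟨K, hK⟩ := hnt
  set S := {m : ℝ | ∀ᶠ x in Bornology.cobounded E, m ≤ u x} with hS
  have hbdd : BddAbove S := ⟨K, fun s hs => by
    obtain ⟨x, h1, h2⟩ := (hK.and_eventually hs).exists
    linarith⟩
  obtain ⟨μ, hμ, hμS⟩ := exists_pos_eventually_le hn hp hα hα0 hR₀ hu hpos
  have hne : S.Nonempty := ⟨μ, hμS⟩
  have hlow : ∀ a < sSup S, ∀ᶠ x in Bornology.cobounded E, a < u x := fun a ha => by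
    obtain ⟨s, hs, has⟩ := exists_lt_of_lt_csSup hne ha
    exact Eventually.mono hs fun x hx => has.trans_le hx
  refine ⟨sSup S, hμ.trans_le (le_csSup hbdd hμS), tendsto_order.2 ⟨hlow, fun b hb => ?_⟩⟩
  obtain ⟨C, hC1, hC⟩ := exists_harnack_sphere hn hp hα hα0
  set m := sSup S with hm
  set ε := (b - m) / (4 * C) with hε
  have hε0 : 0 < ε := div_pos (by linarith) (by linarith)
  have hεC : 2 * C * ε = (b - m) / 2 := by rw [hε]; field_simp; ring
  obtain ⟨R₁, -, hR₁⟩ := (hasBasis_cobounded_norm (E := E)).eventually_iff.1 (hlow (m - ε) (by linarith))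
  have hfreq : ∃ᶠ x in Bornology.cobounded E, u x < m + ε := by
    have : m + ε ∉ S := fun h => by linarith [le_csSup hbdd h]
    simpa [hS, not_eventually] using this
  set R₂ := max R₀ R₁
  have hR2 : 0 ≤ R₂ := le_max_of_le_left hR₀
  have hw : IsSol p {x | R₂ < ‖x‖} fun x => u x + (-m + ε) :=
    (hu.mono fun x (hx : R₂ < ‖x‖) => (le_max_left _ _).trans_lt hx).add_const _
  have hwpos : ∀ x, R₂ < ‖x‖ → 0 < u x + (-m + ε) := fun x hx => by
    have := hR₁ (show R₁ ≤ ‖x‖ from (le_max_right _ _).trans hx.le)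
    linarith
  have h1 := IsSol.eventually_le_of_frequently_le_sphere hp hu
    (isSol_const p _ (m - ε + 2 * C * ε)) ((frequently_sphere_of_frequently hfreq (2 * R₂)).mono ?_)
  · filter_upwards [h1] with x hx
    linarith
  · rintro R ⟨hR, x, rfl, hx⟩ z hz
    have := hC R₂ _ hR2 hw hwpos x z (by linarith) hR.le hz
    have h2 : C * (u x + (-m + ε)) ≤ C * (2 * ε) := by gcongr; linarith
    linarith

end SupercriticalLimits

section Growth

variable {E : Type*} [NormedAddCommGroup E] [InnerProductSpace ℝ E] [FiniteDimensional ℝ E]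
  [MeasurableSpace E] [BorelSpace E]

theorem exists_growth_step [Nontrivial E] {p α : ℝ} (hp : 2 ≤ p)
    (hα : α * (p - 1) = p - Module.finrank ℝ E) (hα0 : 0 < α) (hα1 : α ≤ 1) {ρ : ℝ} (hρ : 0 < ρ)
    (hρ1 : ρ ≤ 1 / 8) {δ : ℝ} (hδ : 0 < δ) :
    ∃ δ' > 0, ∃ η₀ > 0, ∀ η, 0 ≤ η → η ≤ η₀ → ∀ (R : ℝ) (y : E) (u : E → ℝ), 0 < R → ‖y‖ = R →
      IsSol p {x | R / 4 < ‖x‖} u → (∀ x, R / 4 < ‖x‖ → u x ≤ (1 + η) * ‖x‖ ^ α) →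
      (∀ x, ‖x - y‖ ≤ ρ * R → u x ≤ ‖x‖ ^ α - δ * R ^ α) →
      ∀ x, ‖x - y‖ ≤ 2 * ρ * R → u x ≤ ‖x‖ ^ α - δ' * R ^ α := by
  set n : ℝ := (Module.finrank ℝ E : ℝ) with hn
  have hn0 : 0 ≤ n := Nat.cast_nonneg _
  set Λ : ℝ := (n + p - 1) / ρ ^ 2 with hΛ
  have hΛ0 : 0 < Λ := div_pos (by linarith) (by positivity)
  set ε : ℝ := min (min (δ / 2) (α / (64 * p * Λ))) 1 with hε
  have hp0 : 0 < p := by linarith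
  have hε0 : 0 < ε := lt_min (lt_min (by positivity) (by positivity)) one_pos
  have hεδ : ε ≤ δ / 2 := (min_le_left _ _).trans (min_le_left _ _)
  have hεα : ε * (64 * p * Λ) ≤ α := by
    rw [← le_div_iff₀ (by positivity)]; exact (min_le_left _ _).trans (min_le_right _ _)
  set h₀ : ℝ := Real.exp (-Λ * (2 * ρ) ^ 2) - Real.exp (-Λ * (3 * ρ) ^ 2) with hh₀
  have hh0 : 0 < h₀ := by
    rw [hh₀, sub_pos, Real.exp_lt_exp]
    have : 0 < Λ * ρ ^ 2 := by positivity
    nlinarith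
  have hh1 : h₀ ≤ 1 := by
    have : Real.exp (-Λ * (2 * ρ) ^ 2) ≤ 1 := Real.exp_le_one_iff.2 (by
      have : 0 < Λ * (2 * ρ) ^ 2 := by positivity
      linarith)
    linarith [Real.exp_pos (-Λ * (3 * ρ) ^ 2)]
  refine ⟨ε * h₀ / 2, by positivity, min 1 (ε * h₀ / 4), by positivity,
    fun η hη hη0 R y u hR hy hu hub hin x hx => ?_⟩
  have hη1 : η ≤ 1 := hη0.trans (min_le_left _ _)
  have hη2 : η ≤ ε * h₀ / 4 := hη0.trans (min_le_right _ _)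
  have hRα : 0 < R ^ α := Real.rpow_pos_of_pos hR _
  rcases le_or_gt ‖x - y‖ (ρ * R) with hxs | hxs
  · refine (hin x hxs).trans (sub_le_sub_left (mul_le_mul_of_nonneg_right ?_ hRα.le) _)
    nlinarith
  have hnorm : ∀ z : E, ‖z - y‖ ≤ 4 * ρ * R → R / 2 ≤ ‖z‖ ∧ ‖z‖ ≤ 2 * R := fun z hz => by
    have h1 := norm_sub_norm_le y z
    have h2 := norm_sub_norm_le z y
    rw [norm_sub_rev] at h1
    have h3 : 4 * ρ * R ≤ R / 2 := by nlinarith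
    constructor <;> linarith
  set l : ℝ := Λ / R ^ 2 with hl
  have hl0 : 0 < l := by positivity
  have hlR : ∀ t : ℝ, -l * (t * R) ^ 2 = -Λ * t ^ 2 := fun t => by rw [hl]; field_simp
  set Ω : Set E := {z | 3 / 4 * (ρ * R) < ‖z - y‖ ∧ ‖z - y‖ < 4 * ρ * R} with hΩd
  have hcont : Continuous fun z : E => ‖z - y‖ := by fun_prop
  have hΩ : IsOpen Ω := (isOpen_lt continuous_const hcont).inter (isOpen_lt hcont continuous_const)
  have hΩn : ∀ z ∈ Ω, R / 2 ≤ ‖z‖ ∧ ‖z‖ ≤ 2 * R := fun z hz => hnorm z hz.2.le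
  have hRR : R ^ α = R ^ (α - 2) * R ^ 2 := by
    rw [← Real.rpow_natCast, ← Real.rpow_add hR]; congr 1; push_cast; ring
  have hsup : IsSuper p Ω fun z => ‖z - 0‖ ^ α + -(ε * R ^ α) * Real.exp (-l * ‖z - y‖ ^ 2) := by
    refine isSuper_norm_rpow_sub_exp hΩ hp hα hα0 hα1 (by positivity) hl0.le ?_ ?_ ?_ ?_
    · intro h0
      have := (hΩn 0 h0).1
      rw [norm_zero] at this
      linarith
    · intro z hz
      have h1 : (3 / 4 * (ρ * R)) ^ 2 ≤ ‖z - y‖ ^ 2 := by gcongr; exact hz.1.le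
      have h2 : 2 * l * (3 / 4 * (ρ * R)) ^ 2 = 9 / 8 * (n + p - 1) := by
        rw [hl, hΛ]; field_simp; ring
      have h3 : 2 * l * (3 / 4 * (ρ * R)) ^ 2 ≤ 2 * l * ‖z - y‖ ^ 2 := by gcongr
      linarith
    · intro z hz
      rw [sub_zero]
      refine le_trans ?_ (hΩn z hz).1
      nlinarith [hz.2]
    · intro z hz
      rw [sub_zero]
      have h1 : Real.exp (-l * ‖z - y‖ ^ 2) ≤ 1 := Real.exp_le_one_iff.2 (by
        have : 0 ≤ l * ‖z - y‖ ^ 2 := by positivity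
        linarith)
      have h2 : (2 * R) ^ (α - 2) ≤ ‖z‖ ^ (α - 2) :=
        Real.rpow_le_rpow_of_nonpos (by linarith [(hΩn z hz).1]) (hΩn z hz).2 (by linarith)
      have h3 : 1 / 4 * R ^ (α - 2) ≤ (2 * R) ^ (α - 2) := by
        rw [Real.mul_rpow (by norm_num) hR.le]
        gcongr
        calc (1 / 4 : ℝ) = 2 ^ (-2 : ℝ) := by norm_num
          _ ≤ 2 ^ (α - 2) := Real.rpow_le_rpow_of_exponent_le (by norm_num) (by linarith)
      have h4 : 0 < R ^ (α - 2) := Real.rpow_pos_of_pos hR _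
      calc 8 * p * (2 * (ε * R ^ α) * l * Real.exp (-l * ‖z - y‖ ^ 2))
          ≤ 8 * p * (2 * (ε * R ^ α) * l * 1) := by gcongr
        _ = ε * (64 * p * Λ) * (1 / 4 * R ^ (α - 2)) := by rw [hRR, hl]; field_simp; norm_num
        _ ≤ α * ‖z‖ ^ (α - 2) := mul_le_mul hεα (h3.trans h2) (by positivity) hα0.le
  simp only [sub_zero] at hsup
  set k : ℝ := Real.exp (-Λ * (3 * ρ) ^ 2) with hk
  have hsol : IsSol p Ω fun z => (1 + η)⁻¹ * u z + -(ε * R ^ α * k) :=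
    ((hu.mono fun z hz => by
      have := (hΩn z hz).1
      show R / 4 < ‖z‖
      linarith).const_mul _).add_const _
  have hη' : 0 < 1 + η := by linarith
  have hsmall : ∀ z, ‖z - y‖ ≤ 4 * ρ * R → ‖z‖ ^ α ≤ 2 * R ^ α := fun z hz => by
    calc ‖z‖ ^ α ≤ (2 * R) ^ α := Real.rpow_le_rpow (norm_nonneg _) (hnorm z hz).2 hα0.le
      _ = 2 ^ α * R ^ α := Real.mul_rpow (by norm_num) hR.le
      _ ≤ 2 ^ (1 : ℝ) * R ^ α := by
        gcongr
        norm_num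
      _ = _ := by rw [Real.rpow_one]
  have hρR : 0 < ρ * R := by positivity
  have hcmp := hsol.le_of_le_annulus hp hΩ (c := y) (a := ρ * R) (b := 3 * ρ * R)
    (fun z h1 h2 => ⟨by linarith, by linarith⟩) hsup ?_ ?_ hxs.le (hx.trans (by linarith))
  · have h1 : Real.exp (-Λ * (2 * ρ) ^ 2) ≤ Real.exp (-l * ‖x - y‖ ^ 2) := by
      rw [← hlR, Real.exp_le_exp, neg_mul, neg_mul, neg_le_neg_iff]
      gcongr
    have h2 : (1 + η)⁻¹ * u x ≤ ‖x‖ ^ α - ε * R ^ α * h₀ := by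
      have : ε * R ^ α * Real.exp (-Λ * (2 * ρ) ^ 2) ≤ ε * R ^ α * Real.exp (-l * ‖x - y‖ ^ 2) := by
        gcongr
      rw [hh₀]
      linarith
    rw [inv_mul_le_iff₀ hη'] at h2
    have h3 := hsmall x (by linarith)
    have h4 : η * ‖x‖ ^ α ≤ ε * h₀ / 4 * (2 * R ^ α) := by gcongr
    have h5 : 0 ≤ η * (ε * R ^ α * h₀) := by positivity
    linarith
  · intro z hz
    have h1 := hin z hz.le
    have h2 : Real.exp (-l * ‖z - y‖ ^ 2) ≤ 1 := Real.exp_le_one_iff.2 (by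
        have : 0 ≤ l * ‖z - y‖ ^ 2 := by positivity
        linarith)
    have h3 : ε * R ^ α * Real.exp (-l * ‖z - y‖ ^ 2) ≤ ε * R ^ α * 1 := by gcongr
    have h4 : (1 + η)⁻¹ * u z ≤ ‖z‖ ^ α - ε * R ^ α := by
      rw [inv_mul_le_iff₀ hη']
      have h5 : 0 ≤ η * ‖z‖ ^ α := by positivity
      have h6 : (1 + η) * (ε * R ^ α) ≤ 2 * (δ / 2 * R ^ α) := by gcongr; linarith
      linarith
    have : 0 ≤ ε * R ^ α * k := by positivity
    linarith
  · intro z hz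
    have h1 : (1 + η)⁻¹ * u z ≤ ‖z‖ ^ α := by
      rw [inv_mul_le_iff₀ hη']
      exact hub z (by linarith [(hnorm z (by linarith)).1])
    rw [hz, hlR]
    linarith

end Growth

section GrowthLimit

variable {E : Type*} [NormedAddCommGroup E] [InnerProductSpace ℝ E] [FiniteDimensional ℝ E]
  [MeasurableSpace E] [BorelSpace E]

theorem exists_growth_chain [Nontrivial E] {p α : ℝ} (hp : 2 ≤ p)
    (hα : α * (p - 1) = p - Module.finrank ℝ E) (hα0 : 0 < α) (hα1 : α ≤ 1) {ρ : ℝ} (hρ : 0 < ρ)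
    (hρ1 : ρ ≤ 1 / 8) {δ : ℝ} (hδ : 0 < δ) (k : ℕ) :
    ∃ δ' > 0, ∃ η₀ > 0, ∀ η, 0 ≤ η → η ≤ η₀ → ∀ (R : ℝ) (c : ℕ → E) (u : E → ℝ), 0 < R →
      (∀ j, ‖c j‖ = R) → (∀ j, ‖c (j + 1) - c j‖ ≤ ρ * R) →
      IsSol p {x | R / 4 < ‖x‖} u → (∀ x, R / 4 < ‖x‖ → u x ≤ (1 + η) * ‖x‖ ^ α) →
      (∀ x, ‖x - c 0‖ ≤ ρ * R → u x ≤ ‖x‖ ^ α - δ * R ^ α) →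
      ∀ x, ‖x - c k‖ ≤ ρ * R → u x ≤ ‖x‖ ^ α - δ' * R ^ α := by
  induction k with
  | zero => exact ⟨δ, hδ, 1, one_pos, fun η _ _ R c u _ _ _ _ _ h => h⟩
  | succ k ih =>
    obtain ⟨δ₁, hδ₁, η₁, hη₁, h1⟩ := ih
    obtain ⟨δ₂, hδ₂, η₂, hη₂, h2⟩ := exists_growth_step (E := E) hp hα hα0 hα1 hρ hρ1 hδ₁
    refine ⟨δ₂, hδ₂, min η₁ η₂, lt_min hη₁ hη₂, fun η h0 hη R c u hR hc hstep hu hub hin x hx => ?_⟩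
    refine h2 η h0 (hη.trans (min_le_right _ _)) R (c k) u hR (hc k) hu hub
      (h1 η h0 (hη.trans (min_le_left _ _)) R c u hR hc hstep hu hub hin) x ?_
    calc ‖x - c k‖ ≤ ‖x - c (k + 1)‖ + ‖c (k + 1) - c k‖ := norm_sub_le_norm_sub_add_norm_sub _ _ _
      _ ≤ ρ * R + ρ * R := add_le_add hx (hstep k)
      _ = _ := by ring

theorem exists_growth_start [Nontrivial E] {p α : ℝ} (hp : 2 ≤ p)
    (hα : α * (p - 1) = p - Module.finrank ℝ E) (hα0 : 0 < α) (hα1 : α ≤ 1) {m : ℝ} (hm : m < 1) :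
    ∃ ρ > 0, ρ ≤ 1 / 8 ∧ ∃ δ > 0, ∀ η, 0 ≤ η → η ≤ 1 → ∀ (R : ℝ) (y : E) (u : E → ℝ), 0 < R →
      ‖y‖ = R → IsSol p {x | R / 4 < ‖x‖} u → (∀ x, R / 4 < ‖x‖ → u x ≤ (1 + η) * ‖x‖ ^ α) →
      (u y ≤ m * ‖y‖ ^ α) → (0 ≤ u y) →
      ∀ x, ‖x - y‖ ≤ ρ * R → u x ≤ ‖x‖ ^ α - δ * R ^ α := by
  set γ : ℝ := (1 - m) / 16 with hγ
  have hγ0 : 0 < γ := by rw [hγ]; linarith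
  obtain ⟨τ, hτ0, hτ1, hτγ⟩ : ∃ τ : ℝ, 0 < τ ∧ τ ≤ 1 / 4 ∧ τ ^ α ≤ γ := by
    have h1 : Tendsto (fun t : ℝ => t ^ α) (𝓝[>] 0) (𝓝 0) := by
      have := (Real.continuousAt_rpow_const 0 α (Or.inr hα0.le)).tendsto
      rw [Real.zero_rpow hα0.ne'] at this
      exact tendsto_nhdsWithin_of_tendsto_nhds this
    obtain ⟨t, h2, h3⟩ := ((h1.eventually (ge_mem_nhds hγ0)).and
      (Ioo_mem_nhdsGT (show (0 : ℝ) < 1 / 4 by norm_num))).exists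
    exact ⟨t, h3.1, h3.2.le, h2⟩
  refine ⟨min (τ / 2) γ ⊓ (1 / 8), by positivity, min_le_right _ _, γ, hγ0,
    fun η hη hη1 R y u hR hy hu hub hum hu0 x hx => ?_⟩
  have hRα : 0 < R ^ α := Real.rpow_pos_of_pos hR _
  set ρ := min (τ / 2) γ ⊓ (1 / 8)
  have hρ0 : 0 < ρ := by positivity
  have hρτ : ρ ≤ τ / 2 := (min_le_left _ _).trans (min_le_left _ _)
  have hργ : ρ ≤ γ := (min_le_left _ _).trans (min_le_right _ _)
  set K := 4 * R ^ α with hK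
  have hnorm : ∀ z : E, ‖z - y‖ ≤ R / 2 → R / 2 ≤ ‖z‖ ∧ ‖z‖ ≤ 2 * R := fun z hz => by
    have h1 := norm_sub_norm_le y z
    have h2 := norm_sub_norm_le z y
    rw [norm_sub_rev] at h1
    constructor <;> linarith
  have hsmall : ∀ z, ‖z - y‖ ≤ R / 2 → u z ≤ K := fun z hz => by
    have h1 : ‖z‖ ^ α ≤ 2 * R ^ α := by
      calc ‖z‖ ^ α ≤ (2 * R) ^ α := Real.rpow_le_rpow (norm_nonneg _) (hnorm z hz).2 hα0.le
        _ = 2 ^ α * R ^ α := Real.mul_rpow (by norm_num) hR.le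
        _ ≤ 2 ^ (1 : ℝ) * R ^ α := by
          gcongr
          norm_num
        _ = _ := by rw [Real.rpow_one]
    calc u z ≤ (1 + η) * ‖z‖ ^ α := hub z (by linarith [(hnorm z hz).1])
      _ ≤ 2 * (2 * R ^ α) := by gcongr; linarith
      _ = K := by rw [hK]; ring
  rw [hy] at hum
  have hv : IsSol p {x | R / 4 < ‖x‖} fun z => -1 * u z + K := (hu.const_mul _).add_const _
  have hxR : ‖x - y‖ ≤ R / 2 := hx.trans (by nlinarith)
  have hpos : 0 < -1 * u y + K := by nlinarith
  have h1 := hv.cone_le hp hα hα0 (isOpen_norm_gt _) (y := y) (r := R / 2) (by positivity)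
    (fun z hz => by
      rw [mem_closedBall, dist_eq_norm] at hz
      have := (hnorm z hz).1
      show R / 4 < ‖z‖
      linarith) (fun z hz => by linarith [hsmall z hz.le]) hpos hxR
  have h2 : (‖x - y‖ / (R / 2)) ^ α ≤ γ := by
    refine (Real.rpow_le_rpow (by positivity) ?_ hα0.le).trans hτγ
    rw [div_le_iff₀ (by positivity)]
    nlinarith
  have h3 : (1 - γ) * R ^ α ≤ ‖x‖ ^ α := by
    have h4 : (1 - γ) * R ≤ ‖x‖ := by
      have h1 := norm_sub_norm_le y x
      rw [norm_sub_rev] at h1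
      nlinarith
    rcases le_or_gt (1 - γ) 0 with h | h
    · exact (mul_nonpos_of_nonpos_of_nonneg h hRα.le).trans (by positivity)
    calc (1 - γ) * R ^ α = (1 - γ) ^ (1 : ℝ) * R ^ α := by rw [Real.rpow_one]
      _ ≤ (1 - γ) ^ α * R ^ α := by
        gcongr ?_ * _
        exact Real.rpow_le_rpow_of_exponent_ge h (by linarith) hα1
      _ = ((1 - γ) * R) ^ α := (Real.mul_rpow h.le hR.le).symm
      _ ≤ _ := Real.rpow_le_rpow (by positivity) h4 hα0.le
  have h5 : (-1 * u y + K) * (‖x - y‖ / (R / 2)) ^ α ≤ K * γ :=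
    mul_le_mul (by linarith) h2 (by positivity) (by positivity)
  have h6 : u x ≤ m * R ^ α + K * γ := by linarith
  have h7 : m = 1 - 16 * γ := by rw [hγ]; ring
  rw [h7, hK] at h6
  nlinarith

theorem exists_tendsto_div_rpow (hn : 2 ≤ Module.finrank ℝ E) {p α : ℝ} (hp : 2 ≤ p)
    (hα : α * (p - 1) = p - Module.finrank ℝ E) (hα0 : 0 < α) (hα1 : α ≤ 1) {R₀ : ℝ} (hR₀ : 0 ≤ R₀)
    {u : E → ℝ} (hu : IsSol p {x | R₀ < ‖x‖} u) (hpos : ∀ x, R₀ < ‖x‖ → 0 < u x)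
    (htop : Tendsto u (Bornology.cobounded E) atTop) :
    ∃ M > 0, Tendsto (fun x => u x / ‖x‖ ^ α) (Bornology.cobounded E) (𝓝 M) := by
  have : Nontrivial E := Module.nontrivial_of_finrank_pos (R := ℝ) (by omega)
  obtain ⟨C, hC1, hC⟩ := exists_harnack_sphere hn hp hα hα0
  have hC0 : 0 < C := by linarith
  have hnear : ∀ R₁ : ℝ, ∀ᶠ x in Bornology.cobounded E, R₁ < ‖x‖ := fun R₁ =>
    tendsto_norm_cobounded_atTop.eventually (eventually_gt_atTop R₁)
  obtain ⟨B, hB⟩ : ∃ B, ∀ x, ‖x‖ = R₀ + 1 → u x ≤ B := by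
    obtain ⟨B, hB⟩ := (isCompact_sphere (0 : E) (R₀ + 1)).bddAbove_image
      (hu.contDiffOn.continuousOn.mono fun x hx => by
        rw [mem_sphere_zero_iff_norm] at hx
        show R₀ < ‖x‖
        linarith)
    exact ⟨B, fun x hx => hB ⟨x, mem_sphere_zero_iff_norm.2 hx, rfl⟩⟩
  -- `u` grows at least like a multiple of `‖x‖ ^ α`
  obtain ⟨m₀, hm₀, hm⟩ : ∃ m > 0, ∀ᶠ x in Bornology.cobounded E, m * ‖x‖ ^ α ≤ u x := by
    by_contra! hcon
    obtain ⟨x, hxB, hx⟩ := ((htop.eventually (eventually_gt_atTop (|B| + 1))).and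
      (hnear (R₀ + 1))).exists
    have hxα : 0 < ‖x‖ ^ α := Real.rpow_pos_of_pos (by linarith) _
    have hε : 0 < 1 / (‖x‖ ^ α * C) := by positivity
    have h1 := hcon _ hε
    have h2 := hu.le_of_frequently_le_sphere hp (a := R₀ + 1) (by linarith)
      (isSol_affine_norm_rpow hα hα0 hR₀ (1 / ‖x‖ ^ α) |B|) (fun z hz => ?_)
      ((frequently_sphere_of_frequently h1 (2 * R₀)).mono ?_) hx.le
    · rw [one_div_mul_cancel hxα.ne'] at h2
      linarith
    · have : 0 ≤ 1 / ‖x‖ ^ α * ‖z‖ ^ α := by positivity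
      linarith [hB z hz, le_abs_self B]
    · rintro R ⟨hR, w, rfl, hw⟩ z hz
      have h3 := hC R₀ u hR₀ hu hpos w z (by linarith) hR.le hz
      have h4 : C * u w ≤ C * (1 / (‖x‖ ^ α * C) * ‖w‖ ^ α) := by gcongr
      have h5 : C * (1 / (‖x‖ ^ α * C) * ‖w‖ ^ α) = 1 / ‖x‖ ^ α * ‖w‖ ^ α := by field_simp
      rw [hz]
      linarith [abs_nonneg B]
  -- and at most so
  obtain ⟨K₀, hK₀⟩ : ∃ K, ∀ᶠ x in Bornology.cobounded E, u x ≤ K * ‖x‖ ^ α := by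
    by_contra! hcon
    obtain ⟨x, hx⟩ := (hnear (R₀ + 1)).exists
    set D := ‖x‖ ^ α - (R₀ + 1) ^ α
    have hD : 0 < D := sub_pos.2 (Real.rpow_lt_rpow (by linarith) hx hα0)
    have h1 := hcon (C * ((u x + 1) / D))
    have hux : 0 < u x := hpos x (by linarith)
    have h2 := (isSol_affine_norm_rpow hα hα0 hR₀ ((u x + 1) / D)
      (-((u x + 1) / D * (R₀ + 1) ^ α))).le_of_frequently_le_sphere hp (a := R₀ + 1) (by linarith)
      hu (fun z hz => ?_) ((frequently_sphere_of_frequently h1 (2 * R₀)).mono ?_) hx.le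
    · have : (u x + 1) / D * ‖x‖ ^ α + -((u x + 1) / D * (R₀ + 1) ^ α) = (u x + 1) / D * D := by
        ring
      rw [this, div_mul_cancel₀ _ hD.ne'] at h2
      linarith
    · rw [hz]
      linarith [hpos z (by linarith)]
    · rintro R ⟨hR, w, rfl, hw⟩ z hz
      have h3 := hC R₀ u hR₀ hu hpos z w (by linarith) (by rw [hz]; exact hR.le) hz.symm
      have h4 : C * ((u x + 1) / D * ‖w‖ ^ α) ≤ C * u z := by linarith
      have h5 := le_of_mul_le_mul_left h4 hC0
      have h6 : 0 ≤ (u x + 1) / D * (R₀ + 1) ^ α := by positivity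
      rw [hz]
      linarith
  set S := {K : ℝ | ∀ᶠ x in Bornology.cobounded E, u x ≤ K * ‖x‖ ^ α} with hS
  have hlb : ∀ K ∈ S, m₀ ≤ K := fun K hK => by
    obtain ⟨x, ⟨h1, h2⟩, h3⟩ := ((Eventually.and hK hm).and (hnear 0)).exists
    exact le_of_mul_le_mul_right (h2.trans h1) (Real.rpow_pos_of_pos h3 _)
  have hbdd : BddBelow S := ⟨m₀, hlb⟩
  have hne : S.Nonempty := ⟨K₀, hK₀⟩
  set M := sInf S with hMdef
  have hM : 0 < M := hm₀.trans_le (le_csInf hne hlb)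
  have hup : ∀ b > M, ∀ᶠ x in Bornology.cobounded E, u x ≤ b * ‖x‖ ^ α := fun b hb => by
    obtain ⟨s, hs, hsb⟩ := exists_lt_of_csInf_lt hne hb
    filter_upwards [hs] with x hx
    exact hx.trans (by gcongr)
  refine ⟨M, hM, tendsto_order.2 ⟨fun a ha => ?_, fun b hb => ?_⟩⟩
  swap
  · obtain ⟨b', h1, h2⟩ := exists_between hb
    filter_upwards [hup b' h1, hnear 0] with x hx hx0
    exact ((div_le_iff₀ (Real.rpow_pos_of_pos hx0 _)).2 hx).trans_lt h2
  by_contra hcon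
  rw [not_eventually] at hcon
  obtain ⟨ρ, hρ, hρ1, δ, hδ, hstart⟩ := exists_growth_start (E := E) hp hα hα0 hα1 (m := a / M)
    ((div_lt_one hM).2 ha)
  obtain ⟨N, hN⟩ := exists_nat_ge (4 / ρ)
  have hN0 : 0 < N := by
    have : (0 : ℝ) < N := lt_of_lt_of_le (by positivity) hN
    exact_mod_cast this
  obtain ⟨δ', hδ', η₀, hη₀, hchain⟩ := exists_growth_chain (E := E) hp hα hα0 hα1 hρ hρ1 hδ N
  set η := min 1 η₀
  have hη : 0 < η := lt_min one_pos hη₀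
  obtain ⟨R₁, -, hR₁⟩ := (hasBasis_cobounded_norm (E := E)).eventually_iff.1
    (hup ((1 + η) * M) (by nlinarith))
  set R₂ := max R₀ R₁
  have h1 := IsSol.eventually_le_of_frequently_le_sphere hp hu
    (isSol_affine_norm_rpow hα hα0 hR₀ ((1 - δ') * M) 0)
    ((frequently_sphere_of_frequently hcon (4 * R₂)).mono ?_)
  · have h2 : (1 - δ') * M ∈ S := by
      simpa [hS] using h1
    have := csInf_le hbdd h2
    rw [← hMdef] at this
    nlinarith
  · rintro R ⟨hR, y, hy, hya⟩ z hz
    have hR0 : 0 < R := by have := le_max_left R₀ R₁; linarith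
    obtain ⟨c, hc0, hcN, hcR, hstep⟩ := exists_chain_sphere hn hy hz hN0
    have hw : IsSol p {x | R / 4 < ‖x‖} fun x => M⁻¹ * u x :=
      (hu.mono fun x (hx : R / 4 < ‖x‖) => show R₀ < ‖x‖ by
        have := le_max_left R₀ R₁
        linarith).const_mul _
    have hwub : ∀ x, R / 4 < ‖x‖ → M⁻¹ * u x ≤ (1 + η) * ‖x‖ ^ α := fun x hx => by
      rw [inv_mul_le_iff₀ hM]
      have := hR₁ (show R₁ ≤ ‖x‖ by
        have := le_max_right R₀ R₁
        linarith)
      linarith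
    have hyα : 0 < ‖y‖ ^ α := Real.rpow_pos_of_pos (by linarith) _
    have huy : 0 < u y := hpos y (by
      have := le_max_left R₀ R₁
      linarith)
    have h3 := hstart η hη.le (min_le_left _ _) R y _ hR0 hy hw hwub (by
      rw [not_lt, div_le_iff₀ hyα] at hya
      rw [inv_mul_le_iff₀ hM]
      refine hya.trans_eq ?_
      field_simp) (by positivity)
    have h4 := hchain η hη.le (min_le_right _ _) R c _ hR0 hcR (fun j => (hstep j).trans (by
      rw [div_le_iff₀ (Nat.cast_pos.2 hN0)]
      rw [div_le_iff₀ hρ] at hN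
      nlinarith)) hw hwub (by rw [hc0]; exact h3) z (by
      rw [hcN, sub_self, norm_zero]; positivity)
    rw [inv_mul_le_iff₀ hM, ← hz] at h4
    linarith

end GrowthLimit

section SupercriticalQuotient

variable {E : Type*} [NormedAddCommGroup E] [InnerProductSpace ℝ E] [FiniteDimensional ℝ E]
  [MeasurableSpace E] [BorelSpace E]

theorem exists_tendsto_quotient_of_finrank_lt (hn : 2 ≤ Module.finrank ℝ E) {p : ℝ}
    (hp : Module.finrank ℝ E < p) {R₀ : ℝ} (hR₀ : 0 ≤ R₀) {u v : E → ℝ}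
    (hu : IsSol p {x | R₀ < ‖x‖} u) (hupos : ∀ x, R₀ < ‖x‖ → 0 < u x)
    (hv : IsSol p {x | R₀ < ‖x‖} v) (hvpos : ∀ x, R₀ < ‖x‖ → 0 < v x) :
    ∃ l : ℝ≥0∞, Tendsto (fun x => ENNReal.ofReal (u x / v x)) (Bornology.cobounded E) (𝓝 l) := by
  have hn' : (2 : ℝ) ≤ Module.finrank ℝ E := by exact_mod_cast hn
  have hp1 : 0 < p - 1 := by linarith
  set α := (p - Module.finrank ℝ E) / (p - 1) with hαd
  have hα : α * (p - 1) = p - Module.finrank ℝ E := div_mul_cancel₀ _ hp1.ne'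
  have hα0 : 0 < α := div_pos (by linarith) hp1
  have hα1 : α ≤ 1 := (div_le_one hp1).2 (by linarith)
  have hF : Tendsto (fun x : E => ‖x‖ ^ α) (Bornology.cobounded E) atTop :=
    (tendsto_rpow_atTop hα0).comp tendsto_norm_cobounded_atTop
  have hF0 : ∀ᶠ x : E in Bornology.cobounded E, 0 < ‖x‖ ^ α := hF.eventually_gt_atTop 0
  have dich : ∀ w : E → ℝ, IsSol p {x | R₀ < ‖x‖} w → (∀ x, R₀ < ‖x‖ → 0 < w x) →
      (∃ m > 0, Tendsto w (Bornology.cobounded E) (𝓝 m)) ∨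
      ∃ m > 0, Tendsto (fun x => w x / ‖x‖ ^ α) (Bornology.cobounded E) (𝓝 m) := fun w hw hwpos =>
    (tendsto_atTop_or_exists_tendsto hn (by linarith) hα hα0 hR₀ hw hwpos).symm.imp_right
      (exists_tendsto_div_rpow hn (by linarith) hα hα0 hα1 hR₀ hw hwpos)
  rcases dich u hu hupos with ⟨a, ha, hua⟩ | ⟨a, ha, hua⟩ <;>
    rcases dich v hv hvpos with ⟨b, hb, hvb⟩ | ⟨b, hb, hvb⟩
  · exact ⟨_, ENNReal.tendsto_ofReal (hua.div hvb hb.ne')⟩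
  · refine ⟨_, ENNReal.tendsto_ofReal (((hua.div hvb hb.ne').div_atTop hF).congr' ?_)⟩
    filter_upwards [hF0] with x hx
    simp only [Pi.div_apply]
    field_simp
  · refine ⟨⊤, ENNReal.tendsto_ofReal_nhds_top.2 ((((hua.div hvb hb.ne').pos_mul_atTop
      (div_pos ha hb) hF)).congr' ?_)⟩
    filter_upwards [hF0] with x hx
    simp only [Pi.div_apply]
    field_simp
  · refine ⟨_, ENNReal.tendsto_ofReal ((hua.div hvb hb.ne').congr' ?_)⟩
    filter_upwards [hF0] with x hx
    simp only [Pi.div_apply]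
    field_simp

theorem IsPosWeakSol.isSol {d : ℕ} {p : ℝ} (hp : 2 ≤ p) {Ω : Set (EuclideanSpace ℝ (Fin d))}
    (hΩ : IsOpen Ω) {u : EuclideanSpace ℝ (Fin d) → ℝ} (h : IsPosWeakSol p (fun _ => 0) Ω u) :
    IsSol p Ω u := by
  refine ⟨h.1, fun φ hφ hcs hφΩ => integral_inner_gradient_eq_zero_of_smooth hΩ
    ((continuous_flux hp).comp_continuousOn (h.1.continuousOn_gradient hΩ))
    (fun ψ hψ hψcs hψΩ => ?_) hφ hcs hφΩ⟩
  have h1 := h.2.2 ψ hψ hψcs hψΩ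
  rw [← h1, ← setIntegral_eq_integral_of_forall_compl_eq_zero (s := Ω)]
  · refine integral_congr_ae (Eventually.of_forall fun x => ?_)
    simp [flux]
  · intro x hx
    have : gradient ψ x = 0 := image_eq_zero_of_notMem_tsupport fun h =>
        hx (hψΩ (tsupport_gradient_subset ψ h))
    simp [this]

end SupercriticalQuotient

section LogCaccioppoli

theorem pow_mul_le_add {n : ℕ} (hn : n ≠ 0) {a b δ : ℝ} (ha : 0 ≤ a) (hb : 0 ≤ b) (hδ : 0 < δ) :
    a ^ (n - 1) * b ≤ δ * a ^ n + (δ ^ (n - 1))⁻¹ * b ^ n := by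
  obtain ⟨m, rfl⟩ := Nat.exists_eq_succ_of_ne_zero hn
  simp only [Nat.succ_eq_add_one, Nat.add_sub_cancel, pow_succ]
  rcases le_total b (δ * a) with h | h
  · have h1 : a ^ m * b ≤ a ^ m * (δ * a) := by gcongr
    have h2 : 0 ≤ (δ ^ m)⁻¹ * (b ^ m * b) := by positivity
    linarith
  · have h1 : a ≤ b / δ := by rw [le_div_iff₀ hδ]; linarith
    have h2 : a ^ m * b ≤ (b / δ) ^ m * b := by gcongr
    have h3 : (b / δ) ^ m * b = (δ ^ m)⁻¹ * (b ^ m * b) := by rw [div_pow]; field_simp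
    have h4 : 0 ≤ δ * (a ^ m * a) := by positivity
    linarith

variable {E : Type*} [NormedAddCommGroup E] [InnerProductSpace ℝ E]

theorem inner_flux_natCast_self {n : ℕ} (hn : 2 ≤ n) (ξ : E) :
    ⟪flux (n : ℝ) ξ, ξ⟫ = ‖ξ‖ ^ n := by
  rw [flux, real_inner_smul_left, real_inner_self_eq_norm_sq, ← Nat.cast_ofNat, ← Nat.cast_sub hn,
    Real.rpow_natCast, ← pow_add, Nat.sub_add_cancel hn]

theorem norm_flux_natCast {n : ℕ} (hn : 2 ≤ n) (ξ : E) : ‖flux (n : ℝ) ξ‖ = ‖ξ‖ ^ (n - 1) := by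
  rw [flux, norm_smul, ← Nat.cast_ofNat, ← Nat.cast_sub hn, Real.rpow_natCast, norm_pow, norm_norm,
    ← pow_succ]
  congr 1; omega

variable [FiniteDimensional ℝ E]

theorem gradient_log {u : E → ℝ} {x : E} (hu : DifferentiableAt ℝ u x) (h : u x ≠ 0) :
    gradient (fun y => Real.log (u y)) x = (u x)⁻¹ • gradient u x := by
  simp [gradient, (hu.hasFDerivAt.log h).fderiv]

variable [MeasurableSpace E] [BorelSpace E]

/-- Logarithmic Caccioppoli inequality. -/
theorem IsSol.integral_pow_mul_norm_gradient_log_le {n : ℕ} (hn : 2 ≤ n) {Ω : Set E}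
    (hΩ : IsOpen Ω) {u η : E → ℝ} (hu : IsSol (n : ℝ) Ω u) (hpos : ∀ x ∈ Ω, 0 < u x)
    (hη : ContDiff ℝ 1 η) (hηc : HasCompactSupport η) (hηΩ : tsupport η ⊆ Ω) (hη0 : ∀ x, 0 ≤ η x) :
    Integrable (fun x => η x ^ n * ‖gradient (fun y => Real.log (u y)) x‖ ^ n) ∧
    ∫ x, η x ^ n * ‖gradient (fun y => Real.log (u y)) x‖ ^ n ≤
      2 * n * (4 ^ (n - 1)) * ∫ x, ‖gradient η x‖ ^ n := by
  set f : E → ℝ := fun y => Real.log (u y) with hf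
  have hfd : ContDiffOn ℝ 1 f Ω := hu.contDiffOn.log fun x hx => (hpos x hx).ne'
  have hgc := hfd.continuousOn_gradient hΩ
  have hn0 : n ≠ 0 := by omega
  have hcz : ∀ {h : E → ℝ}, ContinuousOn h Ω → Continuous fun x => η x ^ n * h x := by
    intro h hh
    refine continuous_iff_continuousAt.2 fun x => ?_
    by_cases hx : x ∈ Ω
    · exact (hη.continuous.continuousAt.pow n).mul (hh.continuousAt (hΩ.mem_nhds hx))
    · have h0 : η =ᶠ[𝓝 x] 0 := notMem_tsupport_iff_eventuallyEq.1 fun h => hx (hηΩ h)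
      refine (continuousAt_const (y := (0 : ℝ))).congr ?_
      filter_upwards [h0] with y hy
      simp [hy, hn0]
  have hηpow : HasCompactSupport fun x => η x ^ n := hηc.comp_left (g := fun t : ℝ => t ^ n)
    (by simp [hn0])
  have hI1 : Integrable (fun x => η x ^ n * ‖gradient f x‖ ^ n) :=
    (hcz (hgc.norm.pow n)).integrable_of_hasCompactSupport hηpow.mul_right
  refine ⟨hI1, ?_⟩
  set φ : E → ℝ := fun x => η x ^ n * Real.exp (-(n - 1 : ℝ) * f x) with hφ
  have hφc : HasCompactSupport φ := hηpow.mul_right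
  have hφs : tsupport φ ⊆ tsupport η := by
    refine closure_mono fun x hx => ?_
    rw [Function.mem_support] at hx ⊢
    exact fun h => hx (by simp [hφ, h, hn0])
  have hφd : ContDiff ℝ 1 φ := by
    refine contDiff_iff_contDiffAt.2 fun x => ?_
    by_cases hx : x ∈ Ω
    · exact (hη.contDiffAt.pow n).mul
        (contDiffAt_const.mul (hfd.contDiffAt (hΩ.mem_nhds hx))).exp
    · have h0 : φ =ᶠ[𝓝 x] 0 := notMem_tsupport_iff_eventuallyEq.1 fun h => hx (hηΩ (hφs h))
      exact contDiffAt_const.congr_of_eventuallyEq h0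
  have key : ∀ x, ⟪flux (n : ℝ) (gradient u x), gradient φ x⟫ =
      n * (η x ^ (n - 1) * ⟪flux (n : ℝ) (gradient f x), gradient η x⟫) -
        (n - 1) * (η x ^ n * ‖gradient f x‖ ^ n) := by
    intro x
    by_cases hx : x ∈ Ω
    · have hux := hpos x hx
      have hud : DifferentiableAt ℝ u x :=
        (hu.contDiffOn.contDiffAt (hΩ.mem_nhds hx)).differentiableAt one_ne_zero
      have hgu : gradient u x = u x • gradient f x := by
        rw [gradient_log hud hux.ne', smul_smul, mul_inv_cancel₀ hux.ne', one_smul]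
      have hfx : DifferentiableAt ℝ f x := hud.log hux.ne'
      have hηx : DifferentiableAt ℝ η x := hη.differentiable one_ne_zero x
      have hgφ : gradient φ x = Real.exp (-(n - 1 : ℝ) * f x) •
          ((n * η x ^ (n - 1)) • gradient η x - ((n - 1 : ℝ) * η x ^ n) • gradient f x) := by
        have : HasFDerivAt φ _ x :=
          (hηx.hasFDerivAt.pow n).mul ((hfx.hasFDerivAt.const_mul (-(n - 1 : ℝ))).exp)
        simp only [gradient]
        rw [this.fderiv]
        simp only [map_add, map_smulₛₗ, smul_sub, smul_smul]
        simp
        module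
      have he : u x ^ ((n : ℝ) - 1) * Real.exp (-(n - 1 : ℝ) * f x) = 1 := by
        rw [Real.rpow_def_of_pos hux, ← Real.exp_add]
        simp only [hf]; ring_nf; simp
      rw [hgφ, hgu, flux_smul _ hux, real_inner_smul_left, real_inner_smul_right, ← mul_assoc, he,
        one_mul, inner_sub_right, real_inner_smul_right, real_inner_smul_right,
        inner_flux_natCast_self hn]
      ring
    · have h1 : η x = 0 := image_eq_zero_of_notMem_tsupport fun h => hx (hηΩ h)
      have h2 : gradient φ x = 0 := image_eq_zero_of_notMem_tsupport fun h =>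
        hx (hηΩ (hφs (tsupport_gradient_subset φ h)))
      have h3 : gradient η x = 0 := image_eq_zero_of_notMem_tsupport fun h =>
        hx (hηΩ (tsupport_gradient_subset η h))
      simp [h1, h2, h3, hn0]
  have h0 := hu.eq_zero φ hφd hφc (hφs.trans hηΩ)
  simp only [key] at h0
  have hIη : Integrable fun x => ‖gradient η x‖ ^ n :=
    (hη.continuous_gradient.norm.pow n).integrable_of_hasCompactSupport
      (hηc.gradient.norm.comp_left (g := fun t : ℝ => t ^ n) (by simp [hn0]))
  have hI2 : Integrable fun x =>
      η x ^ (n - 1) * ⟪flux (n : ℝ) (gradient f x), gradient η x⟫ := by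
    have hc : Continuous fun x => ⟪flux (n : ℝ) (gradient f x), gradient η x⟫ :=
      continuous_inner_of_tsupport_subset hΩ
        ((continuous_flux (by exact_mod_cast hn)).comp_continuousOn hgc) hη.continuous_gradient
        ((tsupport_gradient_subset η).trans hηΩ)
    refine ((hη.continuous.pow _).mul hc).integrable_of_hasCompactSupport ?_
    refine HasCompactSupport.mul_left ?_
    refine hηc.gradient.mono' (subset_closure.trans' fun x hx => ?_)
    rw [Function.mem_support] at hx ⊢
    exact fun h => hx (by simp [h])
  rw [integral_sub (hI2.const_mul _) (hI1.const_mul _), integral_const_mul,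
    integral_const_mul] at h0
  have hn2 : (2 : ℝ) ≤ n := by exact_mod_cast hn
  have hpt : ∀ x, η x ^ (n - 1) * ⟪flux (n : ℝ) (gradient f x), gradient η x⟫ ≤
      4⁻¹ * (η x ^ n * ‖gradient f x‖ ^ n) + 4 ^ (n - 1) * ‖gradient η x‖ ^ n := by
    intro x
    have h1 := real_inner_le_norm (flux (n : ℝ) (gradient f x)) (gradient η x)
    rw [norm_flux_natCast hn] at h1
    have h2 := pow_mul_le_add hn0 (mul_nonneg (hη0 x) (norm_nonneg (gradient f x)))
      (norm_nonneg (gradient η x)) (δ := 4⁻¹) (by norm_num)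
    rw [mul_pow, mul_pow, inv_pow, inv_inv] at h2
    have h3 := mul_le_mul_of_nonneg_left h1 (pow_nonneg (hη0 x) (n - 1))
    linarith
  have hI := integral_mono hI2 ((hI1.const_mul 4⁻¹).add (hIη.const_mul (4 ^ (n - 1)))) hpt
  simp only [Pi.add_apply] at hI
  rw [integral_add (hI1.const_mul _) (hIη.const_mul _), integral_const_mul,
    integral_const_mul] at hI
  set A := ∫ x, η x ^ n * ‖gradient f x‖ ^ n
  set B := ∫ x, ‖gradient η x‖ ^ n
  have hA : 0 ≤ A := integral_nonneg fun x => by have := hη0 x; positivity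
  have hB : 0 ≤ B := integral_nonneg fun x => by positivity
  have h4 : (n - 1 : ℝ) * A ≤ n * (4⁻¹ * A + 4 ^ (n - 1) * B) := by
    have := mul_le_mul_of_nonneg_left hI (by positivity : (0 : ℝ) ≤ n)
    linarith
  have h6 : 0 ≤ ((n : ℝ) - 2) * A := mul_nonneg (by linarith) hA
  linarith

end LogCaccioppoli

section LogEnergy

variable {E : Type*} [NormedAddCommGroup E] [InnerProductSpace ℝ E] [FiniteDimensional ℝ E]

theorem gradient_comp_smul {h : E → ℝ} (hh : Differentiable ℝ h) (c : ℝ) (x : E) :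
    gradient (fun y => h (c • y)) x = c • gradient h (c • x) := by
  have h1 : HasFDerivAt (fun y : E => c • y) (c • ContinuousLinearMap.id ℝ E) x :=
    (hasFDerivAt_id x).const_smul c
  have h2 := (hh (c • x)).hasFDerivAt.comp x h1
  have h3 : fderiv ℝ (fun y => h (c • y)) x =
    (fderiv ℝ h (c • x)).comp (c • ContinuousLinearMap.id ℝ E) := HasFDerivAt.fderiv h2
  simp only [gradient, h3]
  simp

variable [MeasurableSpace E] [BorelSpace E]

/-- Conformal invariance of the `n`-energy in dimension `n`. -/
theorem integral_norm_gradient_comp_smul {h : E → ℝ} (hh : Differentiable ℝ h) {c : ℝ}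
    (hc : 0 < c) : ∫ x, ‖gradient (fun y => h (c • y)) x‖ ^ Module.finrank ℝ E =
      ∫ x, ‖gradient h x‖ ^ Module.finrank ℝ E := by
  simp only [gradient_comp_smul hh, norm_smul, mul_pow, integral_const_mul]
  rw [Measure.integral_comp_smul volume (fun x => ‖gradient h x‖ ^ Module.finrank ℝ E) c]
  rw [abs_of_pos (by positivity), smul_eq_mul, ← mul_assoc, Real.norm_eq_abs, abs_of_pos hc,
    mul_inv_cancel₀ (by positivity), one_mul]

/-- Cutoff functions of uniformly bounded conformal energy. -/
theorem exists_cutoff_annulus [Nontrivial E] {R₀ R₁ : ℝ} (hR₀ : 0 < R₀) (h01 : R₀ < R₁) :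
    ∃ K : ℝ, ∀ R, R₁ ≤ R → ∃ η : E → ℝ, ContDiff ℝ 1 η ∧ HasCompactSupport η ∧
      tsupport η ⊆ {x | R₀ ≤ ‖x‖} ∧ (∀ x, 0 ≤ η x) ∧ (∀ x, R₁ ≤ ‖x‖ → ‖x‖ ≤ R → η x = 1) ∧
      ∫ x, ‖gradient η x‖ ^ Module.finrank ℝ E ≤ K := by
  set n := Module.finrank ℝ E with hn
  have hn0 : n ≠ 0 := Module.finrank_pos.ne'
  let β : ContDiffBump (0 : E) := ⟨R₀, R₁, hR₀, h01⟩
  let b : ContDiffBump (0 : E) := ⟨1, 2, one_pos, one_lt_two⟩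
  have hβ : ContDiff ℝ 1 (β : E → ℝ) := β.contDiff
  have hb : ContDiff ℝ 1 (b : E → ℝ) := b.contDiff
  have hint : ∀ {h : E → ℝ}, ContDiff ℝ 1 h → HasCompactSupport h →
      Integrable fun x => ‖gradient h x‖ ^ n := fun h1 h2 =>
    (h1.continuous_gradient.norm.pow n).integrable_of_hasCompactSupport
      (h2.gradient.norm.comp_left (g := fun t : ℝ => t ^ n) (by simp [hn0]))
  refine ⟨2 ^ (n - 1) * ((∫ x, ‖gradient b x‖ ^ n) + ∫ x, ‖gradient β x‖ ^ n), fun R hR => ?_⟩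
  have hRpos : 0 < R := by linarith
  set bR : E → ℝ := fun x => b (R⁻¹ • x) with hbR
  have hbRd : ContDiff ℝ 1 bR := hb.comp (contDiff_const_smul R⁻¹)
  have hbRc : HasCompactSupport bR := b.hasCompactSupport.comp_smul (inv_ne_zero hRpos.ne')
  have hone : ∀ x : E, ‖x‖ ≤ R → bR x = 1 := fun x hx => by
    refine b.one_of_mem_closedBall ?_
    rw [mem_closedBall_zero_iff, norm_smul, norm_inv, Real.norm_eq_abs, abs_of_pos hRpos]
    exact inv_mul_le_one_of_le₀ hx hRpos.le
  have hβ0 : ∀ x : E, R₁ ≤ ‖x‖ → β x = 0 := fun x hx => by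
    refine β.zero_of_le_dist ?_
    simpa using hx
  have hβ1 : ∀ x : E, ‖x‖ ≤ R₀ → β x = 1 := fun x hx => by
    refine β.one_of_mem_closedBall ?_
    simpa using hx
  refine ⟨fun x => bR x - β x, hbRd.sub hβ, hbRc.sub β.hasCompactSupport, ?_, ?_, ?_, ?_⟩
  · refine closure_minimal (fun x hx => ?_) (isClosed_le continuous_const continuous_norm)
    by_contra h
    have h' : ‖x‖ ≤ R₀ := (not_le.1 h).le
    exact hx (by simp [hone x (by linarith), hβ1 x h'])
  · intro x
    show 0 ≤ bR x - β x
    rcases le_total ‖x‖ R₁ with h | h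
    · rw [hone x (h.trans hR)]
      exact sub_nonneg.2 β.le_one
    · rw [hβ0 x h, sub_zero]
      exact b.nonneg
  · intro x h1 h2
    show bR x - β x = 1
    rw [hone x h2, hβ0 x h1, sub_zero]
  · have hg : ∀ x, gradient (fun x => bR x - β x) x = gradient bR x - gradient β x := fun x => by
      have : fderiv ℝ (fun x => bR x - β x) x = fderiv ℝ bR x - fderiv ℝ β x :=
        fderiv_fun_sub (hbRd.differentiable one_ne_zero x) (hβ.differentiable one_ne_zero x)
      simp [gradient, this]
    have h1 : ∫ x, ‖gradient bR x‖ ^ n = ∫ x, ‖gradient b x‖ ^ n :=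
      integral_norm_gradient_comp_smul (hb.differentiable one_ne_zero) (inv_pos.2 hRpos)
    rw [← h1, ← integral_add (hint hbRd hbRc) (hint hβ β.hasCompactSupport), ← integral_const_mul]
    refine integral_mono (hint (hbRd.sub hβ) (hbRc.sub β.hasCompactSupport))
      (((hint hbRd hbRc).add (hint hβ β.hasCompactSupport)).const_mul _) fun x => ?_
    simp only [hg]
    calc _ ≤ (‖gradient bR x‖ + ‖gradient β x‖) ^ n := by
          gcongr
          exact norm_sub_le _ _
      _ ≤ _ := add_pow_le (norm_nonneg _) (norm_nonneg _) n

/-- The logarithm of a positive `n`-harmonic function in an exterior domain of an `n`-dimensional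
space has finite `n`-energy near infinity. -/
theorem IsSol.lintegral_norm_gradient_log_lt_top [Nontrivial E] (hn : 2 ≤ Module.finrank ℝ E)
    {R₀ R₁ : ℝ} (hR₀ : 0 ≤ R₀) (h01 : R₀ < R₁) {u : E → ℝ}
    (hu : IsSol (Module.finrank ℝ E : ℝ) {x | R₀ < ‖x‖} u) (hpos : ∀ x, R₀ < ‖x‖ → 0 < u x) :
    ∫⁻ x in {x : E | R₁ ≤ ‖x‖},
      ‖gradient (fun y => Real.log (u y)) x‖ₑ ^ Module.finrank ℝ E < ⊤ := by
  set n := Module.finrank ℝ E with hnd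
  set g := gradient (fun y => Real.log (u y)) with hg
  obtain ⟨K, hK⟩ := exists_cutoff_annulus (E := E) (R₀ := (R₀ + R₁) / 2) (R₁ := R₁)
    (by linarith) (by linarith)
  have hmain : ∀ R, R₁ ≤ R → ∫⁻ x in {x : E | R₁ ≤ ‖x‖} ∩ closedBall 0 R, ‖g x‖ₑ ^ n ≤
      ENNReal.ofReal (2 * n * 4 ^ (n - 1) * K) := by
    intro R hR
    obtain ⟨η, h1, h2, h3, h4, h5, h6⟩ := hK R hR
    have h3' : tsupport η ⊆ {x | R₀ < ‖x‖} := by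
      refine h3.trans fun x hx => ?_
      rw [mem_ofPred_eq] at hx ⊢
      linarith
    obtain ⟨hI, hle⟩ := hu.integral_pow_mul_norm_gradient_log_le hn (isOpen_norm_gt R₀) hpos h1 h2
      h3' h4
    calc _ = ∫⁻ x in {x : E | R₁ ≤ ‖x‖} ∩ closedBall 0 R, ENNReal.ofReal (η x ^ n * ‖g x‖ ^ n) := by
          refine setLIntegral_congr_fun ?_ fun x hx => ?_
          · exact (measurableSet_le measurable_const measurable_norm).inter measurableSet_closedBall
          · rw [h5 x hx.1 (by simpa using hx.2), one_pow, one_mul,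
              ENNReal.ofReal_pow (norm_nonneg _), ofReal_norm]
      _ ≤ ∫⁻ x, ENNReal.ofReal (η x ^ n * ‖g x‖ ^ n) := setLIntegral_le_lintegral _ _
      _ = ENNReal.ofReal (∫ x, η x ^ n * ‖g x‖ ^ n) :=
          (ofReal_integral_eq_lintegral_ofReal hI (Eventually.of_forall fun x => by
            have := h4 x
            positivity)).symm
      _ ≤ _ := by
          refine ENNReal.ofReal_le_ofReal (hle.trans ?_)
          gcongr
  have hunion : {x : E | R₁ ≤ ‖x‖} = ⋃ k : ℕ, {x : E | R₁ ≤ ‖x‖} ∩ closedBall 0 (R₁ + k) := by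
    rw [← inter_iUnion]
    refine (inter_eq_left.2 fun x _ => ?_).symm
    obtain ⟨k, hk⟩ := exists_nat_ge (‖x‖ - R₁)
    exact mem_iUnion.2 ⟨k, by rw [mem_closedBall_zero_iff]; linarith⟩
  rw [hunion, setLIntegral_iUnion_of_directed]
  · exact (iSup_le fun k : ℕ => hmain (R₁ + k) (by simp)).trans_lt ENNReal.ofReal_lt_top
  · refine Monotone.directed_le fun i j hij => ?_
    refine inter_subset_inter_right _ (closedBall_subset_closedBall ?_)
    have : (i : ℝ) ≤ j := by exact_mod_cast hij
    linarith

end LogEnergy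

section Oscillation

theorem ENNReal.le_add_inv_pow_mul_pow {n : ℕ} (hn : n ≠ 0) (s : ℝ≥0∞) {θ : ℝ≥0∞} (h0 : θ ≠ 0)
    (ht : θ ≠ ⊤) : s ≤ θ + (θ ^ (n - 1))⁻¹ * s ^ n := by
  obtain ⟨m, rfl⟩ := Nat.exists_eq_succ_of_ne_zero hn
  simp only [Nat.succ_eq_add_one, Nat.add_sub_cancel, pow_succ]
  rcases le_total s θ with h | h
  · exact h.trans le_self_add
  · refine le_trans ?_ le_add_self
    calc s = (θ ^ m)⁻¹ * (θ ^ m * s) := by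
          rw [← mul_assoc, ENNReal.inv_mul_cancel (pow_ne_zero _ h0) (ENNReal.pow_ne_top ht),
            one_mul]
      _ ≤ _ := by gcongr

theorem lintegral_Ioo_rpow_lt_top {s : ℝ} (hs : -1 < s) :
    ∫⁻ t in Ioo (0 : ℝ) 1, ENNReal.ofReal (t ^ s) < ⊤ :=
  ((intervalIntegral.integrableOn_Ioo_rpow_iff one_pos).2 hs).lintegral_lt_top

variable {E : Type*} [NormedAddCommGroup E] [InnerProductSpace ℝ E] [FiniteDimensional ℝ E]

theorem enorm_sub_le_lintegral_gradient {f : E → ℝ} {s : Set E} (hs : IsOpen s)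
    (hf : ContDiffOn ℝ 1 f s) {x z : E} (h : ∀ t ∈ Icc (0 : ℝ) 1, x + t • z ∈ s) :
    ‖f (x + z) - f x‖ₑ ≤ ‖z‖ₑ * ∫⁻ t in Ioo (0 : ℝ) 1, ‖gradient f (x + t • z)‖ₑ := by
  have hφ : ContDiffOn ℝ 1 (fun t : ℝ => f (x + t • z)) (Icc 0 1) :=
    hf.comp (by fun_prop) h
  have h1 := enorm_sub_le_lintegral_deriv_of_contDiffOn_Icc hφ zero_le_one
  simp only [one_smul, zero_smul, add_zero] at h1
  refine h1.trans ?_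
  rw [setLIntegral_congr Ioo_ae_eq_Icc.symm, ← lintegral_const_mul' _ _ enorm_ne_top]
  refine setLIntegral_mono' measurableSet_Ioo fun t ht => ?_
  have hd : DifferentiableAt ℝ f (x + t • z) :=
    (hf.contDiffAt (hs.mem_nhds (h t (Ioo_subset_Icc_self ht)))).differentiableAt one_ne_zero
  have h2 : HasDerivAt (fun t : ℝ => x + t • z) z t := by
    simpa using ((hasDerivAt_id t).smul_const z).const_add x
  have h3 : deriv (fun t : ℝ => f (x + t • z)) t = fderiv ℝ f (x + t • z) z :=
    (hd.hasFDerivAt.comp_hasDerivAt t h2).deriv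
  rw [h3, mul_comm]
  refine (ContinuousLinearMap.le_opENorm _ z).trans_eq ?_
  congr 1
  simp only [gradient, ← ofReal_norm, LinearIsometryEquiv.norm_map]

variable [MeasurableSpace E] [BorelSpace E]

theorem measurable_gradient (f : E → ℝ) : Measurable (gradient f) :=
  (InnerProductSpace.toDual ℝ E).symm.continuous.measurable.comp (measurable_fderiv ℝ f)

theorem setLIntegral_ball_comp_add_smul {g : E → ℝ≥0∞} (hg : Measurable g) (x : E) {a t : ℝ}
    (ht : 0 < t) :
    ∫⁻ z in ball 0 a, g (x + t • z) =
      ENNReal.ofReal ((t ^ Module.finrank ℝ E)⁻¹) * ∫⁻ w in ball x (t * a), g w := by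
  have h1 : ∀ z : E, (ball (0 : E) a).indicator (fun z => g (x + t • z)) z =
      (ball x (t * a)).indicator g (x + t • z) := fun z => by
    have : z ∈ ball (0 : E) a ↔ x + t • z ∈ ball x (t * a) := by
      simp [mem_ball, dist_eq_norm, norm_smul, abs_of_pos ht, ht]
    by_cases hz : z ∈ ball (0 : E) a
    · rw [indicator_of_mem hz, indicator_of_mem (this.1 hz)]
    · rw [indicator_of_notMem hz, indicator_of_notMem (mt this.2 hz)]
  have hm : Measurable ((ball x (t * a)).indicator g) := hg.indicator measurableSet_ball
  rw [← lintegral_indicator measurableSet_ball, ← lintegral_indicator measurableSet_ball]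
  simp only [h1]
  rw [← lintegral_add_left_eq_self ((ball x (t * a)).indicator g) x,
    ← lintegral_map (f := fun y => (ball x (t * a)).indicator g (x + y))
      (hm.comp (measurable_const_add x)) (measurable_const_smul t),
    Measure.map_addHaar_smul volume ht.ne', lintegral_smul_measure, smul_eq_mul,
    abs_of_pos (by positivity)]

theorem setLIntegral_ball_enorm_sub_le {f : E → ℝ} {s : Set E} (hs : IsOpen s)
    (hf : ContDiffOn ℝ 1 f s) {x : E} {a : ℝ} (hx : ball x a ⊆ s) :
    ∫⁻ z in ball 0 a, ‖f (x + z) - f x‖ₑ ≤ ENNReal.ofReal a *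
      ∫⁻ t in Ioo (0 : ℝ) 1, ∫⁻ z in ball 0 a, ‖gradient f (x + t • z)‖ₑ := by
  have hm : Measurable fun q : E × ℝ => ‖gradient f (x + q.2 • q.1)‖ₑ :=
    ((measurable_gradient f).comp (by fun_prop)).enorm
  rw [lintegral_lintegral_swap (f := fun (t : ℝ) (z : E) => ‖gradient f (x + t • z)‖ₑ)
    (hm.comp measurable_swap).aemeasurable, ← lintegral_const_mul' _ _ ENNReal.ofReal_ne_top]
  refine setLIntegral_mono' measurableSet_ball fun z hz => ?_
  rw [mem_ball_zero_iff] at hz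
  refine (enorm_sub_le_lintegral_gradient hs hf fun t ht => hx ?_).trans ?_
  · rw [mem_ball, dist_eq_norm, add_sub_cancel_left, norm_smul, Real.norm_eq_abs,
      abs_of_nonneg ht.1]
    exact (mul_le_of_le_one_left (norm_nonneg z) ht.2).trans_lt hz
  · gcongr
    rw [← ofReal_norm]
    exact ENNReal.ofReal_le_ofReal hz.le

/-- Weighted Morrey-type estimate at the conformal exponent. -/
theorem exists_setLIntegral_ball_enorm_sub_le (hn : 2 ≤ Module.finrank ℝ E) :
    ∃ C : ℝ≥0∞, C ≠ ⊤ ∧ ∀ (ε : ℝ), 0 < ε → ∀ (f : E → ℝ) (s : Set E), IsOpen s →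
      ContDiffOn ℝ 1 f s → ∀ (x : E) (a : ℝ), 0 < a → ball x a ⊆ s →
      ∫⁻ z in ball 0 a, ‖f (x + z) - f x‖ₑ ≤ ENNReal.ofReal (a ^ Module.finrank ℝ E) *
        (C * ENNReal.ofReal ε + ENNReal.ofReal ((ε ^ (Module.finrank ℝ E - 1))⁻¹) *
          ∫⁻ t in Ioo (0 : ℝ) 1, ENNReal.ofReal (t ^ (-(3 / 2) : ℝ)) *
            ∫⁻ w in ball x (t * a), ‖gradient f w‖ₑ ^ Module.finrank ℝ E) := by
  have : Nontrivial E := Module.nontrivial_of_finrank_pos (R := ℝ) (by omega)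
  set n := Module.finrank ℝ E with hnd
  obtain ⟨m, hm⟩ : ∃ m, n = m + 1 := ⟨n - 1, by omega⟩
  have hm1 : (1 : ℝ) ≤ m := by exact_mod_cast (by omega : 1 ≤ m)
  set κ : ℝ := 1 - 1 / (2 * m) with hκ
  have hκ1 : -1 < -κ := by
    have : 0 < 1 / (2 * (m : ℝ)) := by positivity
    linarith
  set J := ∫⁻ t in Ioo (0 : ℝ) 1, ENNReal.ofReal (t ^ (-κ)) with hJ
  have hJt : J ≠ ⊤ := (lintegral_Ioo_rpow_lt_top hκ1).ne
  refine ⟨volume (ball (0 : E) 1) * J, ENNReal.mul_ne_top measure_ball_lt_top.ne hJt,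
    fun ε hε f s hs hf x a ha hx => (setLIntegral_ball_enorm_sub_le hs hf hx).trans ?_⟩
  have hgm : Measurable fun w => ‖gradient f w‖ₑ ^ n := (measurable_gradient f).enorm.pow_const n
  set F : ℝ → ℝ≥0∞ := fun t => ∫⁻ w in ball x (t * a), ‖gradient f w‖ₑ ^ n with hF
  have hpt : ∀ t ∈ Ioo (0 : ℝ) 1, ∫⁻ z in ball 0 a, ‖gradient f (x + t • z)‖ₑ ≤
      ENNReal.ofReal (ε / a) * volume (ball (0 : E) a) * ENNReal.ofReal (t ^ (-κ)) +
      ENNReal.ofReal ((a / ε) ^ m) * (ENNReal.ofReal (t ^ (-(3 / 2) : ℝ)) * F t) := by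
    intro t ht
    have htk : 0 < t ^ (-κ) := Real.rpow_pos_of_pos ht.1 _
    set θ : ℝ := ε / a * t ^ (-κ) with hθ
    have hθ0 : 0 < θ := by positivity
    calc _ ≤ ∫⁻ z in ball 0 a, (ENNReal.ofReal θ + (ENNReal.ofReal θ ^ m)⁻¹ *
            ‖gradient f (x + t • z)‖ₑ ^ n) := by
          refine lintegral_mono fun z => ?_
          have := ENNReal.le_add_inv_pow_mul_pow (n := n) (by omega) ‖gradient f (x + t • z)‖ₑ
            (ENNReal.ofReal_pos.2 hθ0).ne' ENNReal.ofReal_ne_top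
          rwa [show n - 1 = m by omega] at this
      _ = ENNReal.ofReal θ * volume (ball (0 : E) a) + (ENNReal.ofReal θ ^ m)⁻¹ *
            (ENNReal.ofReal ((t ^ n)⁻¹) * F t) := by
          rw [lintegral_add_left measurable_const, setLIntegral_const, lintegral_const_mul',
            setLIntegral_ball_comp_add_smul hgm x ht.1]
          exact ENNReal.inv_ne_top.2 (pow_ne_zero _ (ENNReal.ofReal_pos.2 hθ0).ne')
      _ = _ := by
          congr 1
          · rw [hθ, ENNReal.ofReal_mul (by positivity)]
            ring
          · rw [← mul_assoc, ← mul_assoc, ← ENNReal.ofReal_pow hθ0.le,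
              ← ENNReal.ofReal_inv_of_pos (by positivity), ← ENNReal.ofReal_mul (by positivity),
              ← ENNReal.ofReal_mul (by positivity)]
            congr 2
            have h1 : ((t ^ (-κ)) ^ m)⁻¹ * (t ^ n)⁻¹ = t ^ (-(3 / 2) : ℝ) := by
              rw [← mul_inv, ← Real.rpow_natCast (t ^ (-κ)) m, ← Real.rpow_mul ht.1.le,
                ← Real.rpow_natCast t n, ← Real.rpow_add ht.1, ← Real.rpow_neg ht.1.le]
              congr 1
              rw [hm, hκ]
              push_cast
              field_simp
              ring
            rw [hθ, mul_pow, mul_inv, mul_assoc, h1, ← inv_pow, inv_div]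
  calc _ ≤ ENNReal.ofReal a * ∫⁻ t in Ioo (0 : ℝ) 1,
        (ENNReal.ofReal (ε / a) * volume (ball (0 : E) a) * ENNReal.ofReal (t ^ (-κ)) +
        ENNReal.ofReal ((a / ε) ^ m) * (ENNReal.ofReal (t ^ (-(3 / 2) : ℝ)) * F t)) := by
        gcongr ENNReal.ofReal a * ?_
        exact setLIntegral_mono' measurableSet_Ioo hpt
    _ = ENNReal.ofReal a * (ENNReal.ofReal (ε / a) * volume (ball (0 : E) a) * J +
        ENNReal.ofReal ((a / ε) ^ m) *
          ∫⁻ t in Ioo (0 : ℝ) 1, (ENNReal.ofReal (t ^ (-(3 / 2) : ℝ)) * F t)) := by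
        rw [lintegral_add_left (by fun_prop), lintegral_const_mul' _ _ ENNReal.ofReal_ne_top,
          lintegral_const_mul' _ _ (ENNReal.mul_ne_top ENNReal.ofReal_ne_top
            measure_ball_lt_top.ne)]
    _ = _ := by
        set I := ∫⁻ t in Ioo (0 : ℝ) 1, (ENNReal.ofReal (t ^ (-(3 / 2) : ℝ)) * F t)
        rw [Measure.addHaar_ball volume (0 : E) ha.le, mul_add, mul_add, ← hnd]
        congr 1
        · have h1 : ENNReal.ofReal a * ENNReal.ofReal (ε / a) = ENNReal.ofReal ε := by
            rw [← ENNReal.ofReal_mul ha.le]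
            congr 1
            field_simp
          rw [← h1]
          ring
        · rw [← mul_assoc, ← mul_assoc, ← ENNReal.ofReal_mul ha.le,
            ← ENNReal.ofReal_mul (by positivity)]
          congr 2
          rw [hm, Nat.add_sub_cancel, div_pow, pow_succ]
          field_simp

end Oscillation

section SphereSelection

variable {E : Type*} [NormedAddCommGroup E] [InnerProductSpace ℝ E] [FiniteDimensional ℝ E]
  [MeasurableSpace E] [BorelSpace E]

theorem measure_ball_mul_enorm_sub_le {f : E → ℝ} {s : Set E}
    (hf : ContinuousOn f s) {x y : E} {a : ℝ} (hx : ball x a ⊆ s) (hxy : ‖x - y‖ ≤ a / 2) :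
    volume (ball (0 : E) (a / 2)) * ‖f x - f y‖ₑ ≤
      (∫⁻ z in ball 0 a, ‖f (x + z) - f x‖ₑ) + ∫⁻ z in ball 0 a, ‖f (y + z) - f y‖ₑ := by
  have ha : 0 ≤ a := by linarith [norm_nonneg (x - y)]
  have hsub : ball (0 : E) (a / 2) ⊆ ball 0 a := ball_subset_ball (by linarith)
  have hm : AEMeasurable (fun z => ‖f (x + z) - f x‖ₑ) (volume.restrict (ball 0 (a / 2))) := by
    refine AEMeasurable.enorm (ContinuousOn.aemeasurable ?_ measurableSet_ball)
    refine (hf.comp (by fun_prop) fun z hz => hx ?_).sub continuousOn_const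
    have := hsub hz
    rw [mem_ball_zero_iff] at this
    simpa [mem_ball, dist_eq_norm] using this
  calc volume (ball (0 : E) (a / 2)) * ‖f x - f y‖ₑ
      = ∫⁻ _ in ball (0 : E) (a / 2), ‖f x - f y‖ₑ := by rw [setLIntegral_const, mul_comm]
    _ ≤ ∫⁻ z in ball (0 : E) (a / 2), (‖f (x + z) - f x‖ₑ + ‖f (x + z) - f y‖ₑ) := by
        refine lintegral_mono fun z => ?_
        rw [← enorm_neg (f (x + z) - f x)]
        refine le_trans (le_of_eq ?_) (enorm_add_le _ _)
        congr 1
        ring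
    _ = (∫⁻ z in ball (0 : E) (a / 2), ‖f (x + z) - f x‖ₑ) +
          ∫⁻ z in ball (0 : E) (a / 2), ‖f (x + z) - f y‖ₑ := lintegral_add_left' hm _
    _ ≤ _ := by
        gcongr ?_ + ?_
        · exact lintegral_mono_set hsub
        · rw [← lintegral_indicator measurableSet_ball, ← lintegral_indicator measurableSet_ball,
            ← lintegral_add_left_eq_self ((ball (0 : E) a).indicator fun z => ‖f (y + z) - f y‖ₑ)
              (x - y)]
          refine lintegral_mono fun z => ?_
          by_cases hz : z ∈ ball (0 : E) (a / 2)
          · rw [indicator_of_mem hz, indicator_of_mem, show y + (x - y + z) = x + z by abel]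
            rw [mem_ball_zero_iff] at hz ⊢
            linarith [norm_add_le (x - y) z]
          · rw [indicator_of_notMem hz]
            exact bot_le

/-- A sphere whose thin neighbourhoods carry little mass. -/
theorem exists_sphere_lintegral_shell_le {G : E → ℝ≥0∞} (hG : Measurable G) {a R : ℝ} (hR : 0 < R) : ∃ ρ ∈ Ioo R (2 * R),
      ∫⁻ t in Ioo (0 : ℝ) 1, ENNReal.ofReal (t ^ (-(3 / 2) : ℝ)) *
        ∫⁻ w in {w : E | |‖w‖ - ρ| < t * a}, G w ≤
      ENNReal.ofReal (2 * a / R) *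
        ((∫⁻ t in Ioo (0 : ℝ) 1, ENNReal.ofReal (t ^ (-(1 / 2) : ℝ))) * ∫⁻ w, G w) := by
  set S : Set (ℝ × ℝ × E) := {q | |‖q.2.2‖ - q.1| < q.2.1 * a} with hS
  have hSm : MeasurableSet S := measurableSet_lt (by fun_prop) (by fun_prop)
  set k : ℝ × ℝ × E → ℝ≥0∞ := S.indicator fun q => G q.2.2 with hk
  have hkm : Measurable k := (hG.comp (by fun_prop)).indicator hSm
  have hin : ∀ ρ t, ∫⁻ w in {w : E | |‖w‖ - ρ| < t * a}, G w = ∫⁻ w, k (ρ, t, w) := fun ρ t => by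
    rw [← lintegral_indicator (measurableSet_lt (by fun_prop) (by fun_prop))]
    rfl
  have hkm3 : Measurable fun q : ℝ × ℝ => ∫⁻ w, k (q.1, q.2, w) :=
    (hkm.comp (by fun_prop : Measurable fun q : (ℝ × ℝ) × E =>
      (q.1.1, q.1.2, q.2))).lintegral_prod_right'
  have hcm : Measurable fun q : ℝ × ℝ => ENNReal.ofReal (q.2 ^ (-(3 / 2) : ℝ)) *
      ∫⁻ w, k (q.1, q.2, w) := by fun_prop
  have hΦm : Measurable fun ρ => ∫⁻ t in Ioo (0 : ℝ) 1, ENNReal.ofReal (t ^ (-(3 / 2) : ℝ)) *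
      ∫⁻ w, k (ρ, t, w) := hcm.lintegral_prod_right'
  simp only [hin]
  have hvol : volume (Ioo R (2 * R)) = ENNReal.ofReal R := by
    rw [Real.volume_Ioo]; congr 1; ring
  obtain ⟨ρ, hρ, hle⟩ := exists_le_setLAverage (μ := volume) (s := Ioo R (2 * R))
    (by rw [hvol]; exact (ENNReal.ofReal_pos.2 hR).ne') (by rw [hvol]; exact ENNReal.ofReal_ne_top)
    hΦm.aemeasurable
  refine ⟨ρ, hρ, hle.trans ?_⟩
  rw [setLAverage_eq, hvol, lintegral_lintegral_swap hcm.aemeasurable]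
  have hpt : ∀ t ∈ Ioo (0 : ℝ) 1, ∫⁻ ρ in Ioo R (2 * R), ENNReal.ofReal (t ^ (-(3 / 2) : ℝ)) *
      ∫⁻ w, k (ρ, t, w) ≤
      ENNReal.ofReal (t ^ (-(1 / 2) : ℝ)) * (ENNReal.ofReal (2 * a) * ∫⁻ w, G w) := by
    intro t ht
    have hkt : Measurable (Function.uncurry fun (ρ : ℝ) (w : E) => k (ρ, t, w)) :=
      hkm.comp (by fun_prop : Measurable fun q : ℝ × E => (q.1, t, q.2))
    rw [lintegral_const_mul' _ _ ENNReal.ofReal_ne_top]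
    calc _ ≤ ENNReal.ofReal (t ^ (-(3 / 2) : ℝ)) * ∫⁻ ρ, ∫⁻ w, k (ρ, t, w) := by
          gcongr
          exact Measure.restrict_le_self
      _ = ENNReal.ofReal (t ^ (-(3 / 2) : ℝ)) * ∫⁻ w, ∫⁻ ρ, k (ρ, t, w) := by
          rw [lintegral_lintegral_swap hkt.aemeasurable]
      _ = ENNReal.ofReal (t ^ (-(3 / 2) : ℝ)) * ∫⁻ w, G w * ENNReal.ofReal (2 * (t * a)) := by
          congr 2
          funext w
          have : ∀ ρ, k (ρ, t, w) = (ball ‖w‖ (t * a)).indicator (fun _ => G w) ρ := fun ρ => by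
            by_cases h : |‖w‖ - ρ| < t * a
            · rw [indicator_of_mem, hk, indicator_of_mem]
              · exact h
              · rw [mem_ball, dist_comm]; exact h
            · rw [indicator_of_notMem, hk, indicator_of_notMem]
              · exact h
              · rw [mem_ball, dist_comm]; exact h
          simp only [this]
          rw [lintegral_indicator measurableSet_ball, setLIntegral_const, Real.volume_ball]
      _ = _ := by
          rw [lintegral_mul_const' _ _ ENNReal.ofReal_ne_top,
            mul_comm (∫⁻ w, G w), ← mul_assoc, ← mul_assoc (ENNReal.ofReal (t ^ (-(1 / 2) : ℝ))),
            ← ENNReal.ofReal_mul (Real.rpow_nonneg ht.1.le _),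
            ← ENNReal.ofReal_mul (Real.rpow_nonneg ht.1.le _)]
          congr 2
          have : t ^ (-(1 / 2) : ℝ) = t ^ (-(3 / 2) : ℝ) * t := by
            rw [← Real.rpow_add_one ht.1.ne']; norm_num
          rw [this]; ring
  calc _ ≤ (∫⁻ t in Ioo (0 : ℝ) 1, ENNReal.ofReal (t ^ (-(1 / 2) : ℝ)) *
          (ENNReal.ofReal (2 * a) * ∫⁻ w, G w)) / ENNReal.ofReal R := by
        gcongr ?_ / _
        exact setLIntegral_mono' measurableSet_Ioo hpt
    _ = _ := by
        rw [lintegral_mul_const _ (by fun_prop), ENNReal.ofReal_div_of_pos hR]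
        generalize ∫⁻ t in Ioo (0 : ℝ) 1, ENNReal.ofReal (t ^ (-(1 / 2) : ℝ)) = J
        rw [div_eq_mul_inv, div_eq_mul_inv]
        ring

end SphereSelection

section SmallOscillation

variable {E : Type*} [NormedAddCommGroup E] [InnerProductSpace ℝ E]

theorem enorm_sub_le_of_chain_sphere (hn : 2 ≤ Module.finrank ℝ E) {f : E → ℝ} {ρ r : ℝ} {N : ℕ}
    (hN : 0 < N) (hr : 4 * ρ / N ≤ r) {M : ℝ≥0∞}
    (h : ∀ x y, ‖x‖ = ρ → ‖y‖ = ρ → ‖x - y‖ ≤ r → ‖f x - f y‖ₑ ≤ M) {x y : E} (hx : ‖x‖ = ρ)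
    (hy : ‖y‖ = ρ) : ‖f x - f y‖ₑ ≤ N * M := by
  obtain ⟨c, h0, hcN, h1, h2⟩ := exists_chain_sphere hn hx hy hN
  have := edist_le_range_sum_edist (fun k => f (c k)) N
  rw [h0, hcN, edist_eq_enorm_sub] at this
  refine this.trans ((Finset.sum_le_card_nsmul _ _ M fun k _ => ?_).trans_eq (by simp))
  rw [edist_comm, edist_eq_enorm_sub]
  exact h _ _ (h1 _) (h1 _) ((h2 k).trans hr)

variable [FiniteDimensional ℝ E] [MeasurableSpace E] [BorelSpace E]

/-- Two functions of small conformal energy have small oscillation on a common sphere. -/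
theorem exists_sphere_enorm_sub_le (hn : 2 ≤ Module.finrank ℝ E) :
    ∃ C : ℝ≥0∞, C ≠ ⊤ ∧ ∀ (R : ℝ), 0 < R → ∀ f₁ f₂ : E → ℝ,
      ContDiffOn ℝ 1 f₁ {x | R / 2 < ‖x‖} → ContDiffOn ℝ 1 f₂ {x | R / 2 < ‖x‖} →
      ∀ (ε : ℝ), 0 < ε → ∃ ρ ∈ Ioo R (2 * R), ∀ x y : E, ‖x‖ = ρ → ‖y‖ = ρ →
      ∀ f, f = f₁ ∨ f = f₂ → ‖f x - f y‖ₑ ≤ C * (ENNReal.ofReal ε +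
        ENNReal.ofReal ((ε ^ (Module.finrank ℝ E - 1))⁻¹) *
        ∫⁻ w in {w : E | R / 2 < ‖w‖}, (‖gradient f₁ w‖ₑ ^ Module.finrank ℝ E +
          ‖gradient f₂ w‖ₑ ^ Module.finrank ℝ E)) := by
  have : Nontrivial E := Module.nontrivial_of_finrank_pos (R := ℝ) (by omega)
  obtain ⟨C, hC, hmor⟩ := exists_setLIntegral_ball_enorm_sub_le (E := E) hn
  set n := Module.finrank ℝ E with hnd
  set J := ∫⁻ t in Ioo (0 : ℝ) 1, ENNReal.ofReal (t ^ (-(1 / 2) : ℝ)) with hJ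
  have hJt : J ≠ ⊤ := (lintegral_Ioo_rpow_lt_top (by norm_num)).ne
  have hω0 : volume (ball (0 : E) 1) ≠ 0 := (measure_ball_pos volume 0 one_pos).ne'
  have hωt : volume (ball (0 : E) 1) ≠ ⊤ := measure_ball_lt_top.ne
  set ω := volume (ball (0 : E) 1)
  refine ⟨64 * (ω⁻¹ * (2 ^ n * (2 * (C + J)))), by finiteness, fun R hR f₁ f₂ hf₁ hf₂ ε hε => ?_⟩
  set s := {x : E | R / 2 < ‖x‖} with hs
  have hso : IsOpen s := isOpen_norm_gt _
  set k : E → ℝ≥0∞ := fun w => ‖gradient f₁ w‖ₑ ^ n + ‖gradient f₂ w‖ₑ ^ n with hk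
  have hkm : Measurable k := ((measurable_gradient f₁).enorm.pow_const n).add
    ((measurable_gradient f₂).enorm.pow_const n)
  obtain ⟨ρ, hρ, hle⟩ := exists_sphere_lintegral_shell_le (hkm.indicator hso.measurableSet)
    (a := R / 4) hR
  rw [lintegral_indicator hso.measurableSet] at hle
  set En := ∫⁻ w in s, k w
  set ε' := ENNReal.ofReal ((ε ^ (n - 1))⁻¹)
  refine ⟨ρ, hρ, fun x y hx hy f hf => ?_⟩
  have hball : ∀ x : E, ‖x‖ = ρ → ball x (R / 4) ⊆ s := fun x hx w hw => by
    rw [mem_ball, dist_comm, dist_eq_norm] at hw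
    have := norm_sub_norm_le x w
    show R / 2 < ‖w‖
    linarith [hρ.1]
  have hfd : ContDiffOn ℝ 1 f s := by rcases hf with rfl | rfl <;> assumption
  have hfk : ∀ w, ‖gradient f w‖ₑ ^ n ≤ k w := fun w => by
    rcases hf with rfl | rfl
    · exact le_self_add
    · exact le_add_self
  have hA : ∀ x : E, ‖x‖ = ρ → ∫⁻ z in ball 0 (R / 4), ‖f (x + z) - f x‖ₑ ≤
      ENNReal.ofReal ((R / 4) ^ n) * ((C + J) * (ENNReal.ofReal ε + ε' * En)) := by
    intro x hx
    refine (hmor ε hε f s hso hfd x (R / 4) (by linarith) (hball x hx)).trans ?_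
    gcongr ENNReal.ofReal ((R / 4) ^ n) * ?_
    have hI : ∫⁻ t in Ioo (0 : ℝ) 1, ENNReal.ofReal (t ^ (-(3 / 2) : ℝ)) *
        ∫⁻ w in ball x (t * (R / 4)), ‖gradient f w‖ₑ ^ n ≤ J * En := by
      refine le_trans ?_ (hle.trans ?_)
      · refine setLIntegral_mono' measurableSet_Ioo fun t ht => ?_
        gcongr ENNReal.ofReal (t ^ (-(3 / 2) : ℝ)) * ?_
        have hts : ball x (t * (R / 4)) ⊆ s := (ball_subset_ball
          (mul_le_of_le_one_left (by linarith) ht.2.le)).trans (hball x hx)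
        calc _ ≤ ∫⁻ w in ball x (t * (R / 4)), s.indicator k w :=
              setLIntegral_mono' measurableSet_ball fun w hw => by
                rw [indicator_of_mem (hts hw)]
                exact hfk w
          _ ≤ _ := by
              refine lintegral_mono_set fun w hw => ?_
              rw [mem_ball, dist_eq_norm] at hw
              rw [← hx]
              exact (abs_norm_sub_norm_le w x).trans_lt hw
      · refine mul_le_of_le_one_left' ?_
        rw [ENNReal.ofReal_le_one]
        rw [div_le_one hR]
        linarith
    calc _ ≤ C * ENNReal.ofReal ε + ε' * (J * En) := by gcongr
      _ ≤ C * ENNReal.ofReal ε + ε' * (J * En) + (J * ENNReal.ofReal ε + C * (ε' * En)) :=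
          le_self_add
      _ = _ := by ring
  have hpair : ∀ x y : E, ‖x‖ = ρ → ‖y‖ = ρ → ‖x - y‖ ≤ R / 4 / 2 → ‖f x - f y‖ₑ ≤
      ω⁻¹ * (2 ^ n * (2 * ((C + J) * (ENNReal.ofReal ε + ε' * En)))) := by
    intro x y hx hy hxy
    have h1 := (measure_ball_mul_enorm_sub_le hfd.continuousOn (hball x hx) hxy).trans
      (add_le_add (hA x hx) (hA y hy))
    rw [Measure.addHaar_ball volume (0 : E) (by linarith), ← hnd] at h1
    have h2 : ENNReal.ofReal ((R / 4) ^ n) = 2 ^ n * ENNReal.ofReal ((R / 4 / 2) ^ n) := by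
      rw [← ENNReal.ofReal_ofNat 2, ← ENNReal.ofReal_pow (by norm_num),
        ← ENNReal.ofReal_mul (by positivity), ← mul_pow]
      congr 2
      ring
    have hb0 : ENNReal.ofReal ((R / 4 / 2) ^ n) ≠ 0 := (ENNReal.ofReal_pos.2 (by positivity)).ne'
    rw [h2] at h1
    have h3 := calc
      ENNReal.ofReal ((R / 4 / 2) ^ n) * (ω * ‖f x - f y‖ₑ)
        = ENNReal.ofReal ((R / 4 / 2) ^ n) * ω * ‖f x - f y‖ₑ := by ring
      _ ≤ _ := h1
      _ = ENNReal.ofReal ((R / 4 / 2) ^ n) *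
          (2 ^ n * (2 * ((C + J) * (ENNReal.ofReal ε + ε' * En)))) := by ring
    rw [ENNReal.mul_le_mul_iff_right hb0 ENNReal.ofReal_ne_top] at h3
    rw [← ENNReal.mul_le_mul_iff_right hω0 hωt, ← mul_assoc ω ω⁻¹,
      ENNReal.mul_inv_cancel hω0 hωt, one_mul]
    exact h3
  refine (enorm_sub_le_of_chain_sphere hn (N := 64) (by norm_num) (r := R / 4 / 2) ?_ hpair hx
    hy).trans_eq ?_
  · push_cast
    linarith [hρ.2]
  · push_cast
    ring

end SmallOscillation

section ConformalQuotient

variable {E : Type*} [NormedAddCommGroup E] [InnerProductSpace ℝ E] [FiniteDimensional ℝ E]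
  [MeasurableSpace E] [BorelSpace E]

theorem tendsto_setLIntegral_norm_gt {k : E → ℝ≥0∞} {R₁ : ℝ}
    (hk : ∫⁻ x in {x : E | R₁ ≤ ‖x‖}, k x < ⊤) :
    Tendsto (fun R : ℝ => ∫⁻ x in {x : E | R < ‖x‖}, k x) atTop (𝓝 0) := by
  have hm : ∀ R : ℝ, MeasurableSet {x : E | R < ‖x‖} := fun R => (isOpen_norm_gt R).measurableSet
  have h := tendsto_measure_iInter_atTop (μ := volume.withDensity k)
    (s := fun R : ℝ => {x : E | R < ‖x‖}) (fun R => (hm R).nullMeasurableSet)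
    (fun R S h x (hx : S < ‖x‖) => h.trans_lt hx) ⟨R₁, ?_⟩
  · have h0 : ⋂ R : ℝ, {x : E | R < ‖x‖} = ∅ :=
      eq_empty_of_forall_notMem fun x hx => lt_irrefl ‖x‖ (mem_iInter.1 hx ‖x‖)
    rw [h0, measure_empty] at h
    refine h.congr fun R => ?_
    rw [Function.comp_apply, withDensity_apply _ (hm R)]
  · rw [withDensity_apply _ (hm R₁)]
    exact ((lintegral_mono_set fun x (hx : R₁ < ‖x‖) => hx.le).trans_lt hk).ne

theorem frequently_sphere_quotient_le (hn : 2 ≤ Module.finrank ℝ E) {R₀ : ℝ} (hR₀ : 0 ≤ R₀)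
    {u v : E → ℝ} (hu : IsSol (Module.finrank ℝ E : ℝ) {x | R₀ < ‖x‖} u)
    (hupos : ∀ x, R₀ < ‖x‖ → 0 < u x) (hv : IsSol (Module.finrank ℝ E : ℝ) {x | R₀ < ‖x‖} v)
    (hvpos : ∀ x, R₀ < ‖x‖ → 0 < v x) {b : ℝ} (hb : 1 < b) :
    ∃ᶠ R in atTop, ∀ x y : E, ‖x‖ = R → ‖y‖ = R → u x / v x ≤ b * (u y / v y) := by
  have : Nontrivial E := Module.nontrivial_of_finrank_pos (R := ℝ) (by omega)
  obtain ⟨C, hC, hsph⟩ := exists_sphere_enorm_sub_le (E := E) hn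
  set n := Module.finrank ℝ E with hnd
  set f₁ : E → ℝ := fun y => Real.log (u y) with hf₁
  set f₂ : E → ℝ := fun y => Real.log (v y) with hf₂
  have hd₁ : ContDiffOn ℝ 1 f₁ {x | R₀ < ‖x‖} := hu.contDiffOn.log fun x hx => (hupos x hx).ne'
  have hd₂ : ContDiffOn ℝ 1 f₂ {x | R₀ < ‖x‖} := hv.contDiffOn.log fun x hx => (hvpos x hx).ne'
  have hfin : ∫⁻ x in {x : E | R₀ + 1 ≤ ‖x‖}, (‖gradient f₁ x‖ₑ ^ n + ‖gradient f₂ x‖ₑ ^ n) < ⊤ := by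
    rw [lintegral_add_left ((measurable_gradient f₁).enorm.pow_const n)]
    exact ENNReal.add_lt_top.2
      ⟨hu.lintegral_norm_gradient_log_lt_top hn hR₀ (lt_add_one R₀) hupos,
        hv.lintegral_norm_gradient_log_lt_top hn hR₀ (lt_add_one R₀) hvpos⟩
  have htail := (tendsto_setLIntegral_norm_gt hfin).comp
    (tendsto_id.atTop_div_const (two_pos (α := ℝ)))
  set δ := Real.log b / 2 with hδ
  have hδ0 : 0 < δ := half_pos (Real.log_pos hb)
  set ε := δ / (C.toReal + 1) with hε
  have hCr : 0 ≤ C.toReal := ENNReal.toReal_nonneg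
  have hε0 : 0 < ε := by positivity
  have hlim : Tendsto (fun R : ℝ => C * (ENNReal.ofReal ε + ENNReal.ofReal ((ε ^ (n - 1))⁻¹) *
      ∫⁻ w in {w : E | R / 2 < ‖w‖}, (‖gradient f₁ w‖ₑ ^ n + ‖gradient f₂ w‖ₑ ^ n))) atTop
      (𝓝 (C * (ENNReal.ofReal ε + ENNReal.ofReal ((ε ^ (n - 1))⁻¹) * 0))) :=
    ENNReal.Tendsto.const_mul (tendsto_const_nhds.add
      (ENNReal.Tendsto.const_mul htail (Or.inr ENNReal.ofReal_ne_top))) (Or.inr hC)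
  have hlt : C * (ENNReal.ofReal ε + ENNReal.ofReal ((ε ^ (n - 1))⁻¹) * 0) <
      ENNReal.ofReal δ := by
    rw [mul_zero, add_zero, ← ENNReal.ofReal_toReal hC, ← ENNReal.ofReal_mul hCr]
    refine (ENNReal.ofReal_lt_ofReal_iff hδ0).2 ?_
    rw [hε, mul_div_assoc', div_lt_iff₀ (by positivity)]
    linarith
  have hev := hlim.eventually_lt_const hlt
  rw [frequently_atTop]
  intro a
  obtain ⟨R, hR, hRa, hR0⟩ := (hev.and ((eventually_ge_atTop a).and
    (eventually_gt_atTop (2 * R₀)))).exists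
  have hsub : {x : E | R / 2 < ‖x‖} ⊆ {x | R₀ < ‖x‖} := fun x (hx : R / 2 < ‖x‖) => by
    show R₀ < ‖x‖
    linarith
  obtain ⟨ρ, hρ, hosc⟩ := hsph R (by linarith) f₁ f₂ (hd₁.mono hsub) (hd₂.mono hsub) ε hε0
  refine ⟨ρ, by linarith [hρ.1], fun x y hx hy => ?_⟩
  have hle : ∀ f, f = f₁ ∨ f = f₂ → |f x - f y| ≤ δ := fun f hf => by
    have := (hosc x y hx hy f hf).trans hR.le
    rwa [← ofReal_norm, ENNReal.ofReal_le_ofReal_iff hδ0.le] at this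
  have h1 := abs_le.1 (hle f₁ (Or.inl rfl))
  have h2 := abs_le.1 (hle f₂ (Or.inr rfl))
  have hpx : R₀ < ‖x‖ := by linarith [hρ.1]
  have hpy : R₀ < ‖y‖ := by linarith [hρ.1]
  have hux := hupos x hpx
  have huy := hupos y hpy
  have hvx := hvpos x hpx
  have hvy := hvpos y hpy
  rw [← Real.log_le_log_iff (by positivity) (by positivity),
    Real.log_mul (by positivity) (by positivity), Real.log_div hux.ne' hvx.ne',
    Real.log_div huy.ne' hvy.ne']
  simp only [hf₁, hf₂] at h1 h2
  linarith [h1.2, h2.1]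

theorem exists_tendsto_quotient_of_eq_finrank (hn : 2 ≤ Module.finrank ℝ E) {R₀ : ℝ} (hR₀ : 0 ≤ R₀)
    {u v : E → ℝ} (hu : IsSol (Module.finrank ℝ E : ℝ) {x | R₀ < ‖x‖} u)
    (hupos : ∀ x, R₀ < ‖x‖ → 0 < u x) (hv : IsSol (Module.finrank ℝ E : ℝ) {x | R₀ < ‖x‖} v)
    (hvpos : ∀ x, R₀ < ‖x‖ → 0 < v x) :
    ∃ l : ℝ≥0∞, Tendsto (fun x => ENNReal.ofReal (u x / v x)) (Bornology.cobounded E) (𝓝 l) := by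
  have : Nontrivial E := Module.nontrivial_of_finrank_pos (R := ℝ) (by omega)
  have hn' : (2 : ℝ) ≤ Module.finrank ℝ E := by exact_mod_cast hn
  have hev : ∀ᶠ x in Bornology.cobounded E, R₀ < ‖x‖ :=
    tendsto_norm_cobounded_atTop.eventually_gt_atTop R₀
  set Q : E → ℝ≥0∞ := fun x => ENNReal.ofReal (u x / v x) with hQ
  refine ⟨limsup Q (Bornology.cobounded E), tendsto_of_le_liminf_of_limsup_le ?_ le_rfl⟩
  by_contra! h
  obtain ⟨c, hc1, hc⟩ := ENNReal.lt_iff_exists_nnreal_btwn.1 h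
  obtain ⟨c', hcc', hc2⟩ := ENNReal.lt_iff_exists_nnreal_btwn.1 hc
  have hc0 : (0 : ℝ) < c := by
    have : (0 : ℝ≥0∞) < c := bot_le.trans_lt hc1
    exact_mod_cast this
  have hcc : (c : ℝ) < c' := by exact_mod_cast hcc'
  have hfreq := frequently_sphere_quotient_le hn hR₀ hu hupos hv hvpos
    ((one_lt_div hc0).2 hcc)
  have hfreq2 : ∃ᶠ R in atTop, (∀ x : E, ‖x‖ = R → u x ≤ c' * v x) ∨
      ∀ x : E, ‖x‖ = R → c * v x ≤ u x := by
    refine (hfreq.and_eventually (eventually_gt_atTop R₀)).mono fun R ⟨hR, hRR⟩ => ?_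
    by_contra! hcon
    obtain ⟨⟨x, hx, hx'⟩, y, hy, hy'⟩ := hcon
    have hvx := hvpos x (hx ▸ hRR)
    have hvy := hvpos y (hy ▸ hRR)
    have h1 := hR x y hx hy
    have h2 : (c' : ℝ) < u x / v x := (lt_div_iff₀ hvx).2 hx'
    have h3 : u y / v y < c := (div_lt_iff₀ hvy).2 hy'
    have h4 : (c' / c : ℝ) * (u y / v y) < c' / c * c :=
      mul_lt_mul_of_pos_left h3 (div_pos (hc0.trans hcc) hc0)
    rw [div_mul_cancel₀ _ hc0.ne'] at h4
    linarith
  rcases frequently_or_distrib.1 hfreq2 with hf | hf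
  · have h1 := hu.eventually_le_of_frequently_le_sphere hn' (hv.const_mul c') hf
    refine hc2.not_ge (limsup_le_of_le (by isBoundedDefault) ?_)
    filter_upwards [h1, hev] with x hx hx0
    rw [hQ, ← ENNReal.ofReal_coe_nnreal]
    exact ENNReal.ofReal_le_ofReal ((div_le_iff₀ (hvpos x hx0)).2 hx)
  · have h1 := (hv.const_mul c).eventually_le_of_frequently_le_sphere hn' hu hf
    refine hc1.not_ge (le_liminf_of_le (by isBoundedDefault) ?_)
    filter_upwards [h1, hev] with x hx hx0
    rw [hQ, ← ENNReal.ofReal_coe_nnreal]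
    exact ENNReal.ofReal_le_ofReal ((le_div_iff₀ (hvpos x hx0)).2 hx)

end ConformalQuotient

theorem stmt12 (d : ℕ) (hd : 2 ≤ d) (p : ℝ) (hpd : (d : ℝ) ≤ p) (R₀ : ℝ) (hR₀ : 0 < R₀)
    (u v : EuclideanSpace ℝ (Fin d) → ℝ)
    (hu : IsPosWeakSol p (fun _ => 0) {x : EuclideanSpace ℝ (Fin d) | R₀ < ‖x‖} u)
    (hv : IsPosWeakSol p (fun _ => 0) {x : EuclideanSpace ℝ (Fin d) | R₀ < ‖x‖} v) :
    ∃ l : ℝ≥0∞, Tendsto (fun x => ENNReal.ofReal (u x / v x))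
      (Bornology.cobounded (EuclideanSpace ℝ (Fin d))) (𝓝 l) := by
  have hp2 : (2 : ℝ) ≤ p := le_trans (by exact_mod_cast hd) hpd
  have hus := hu.isSol hp2 (isOpen_norm_gt R₀)
  have hvs := hv.isSol hp2 (isOpen_norm_gt R₀)
  have hfr : Module.finrank ℝ (EuclideanSpace ℝ (Fin d)) = d := finrank_euclideanSpace_fin
  rcases hpd.lt_or_eq with h | rfl
  · exact exists_tendsto_quotient_of_finrank_lt (by rwa [hfr]) (by rwa [hfr]) hR₀.le hus hu.2.1
      hvs hv.2.1
  · exact exists_tendsto_quotient_of_eq_finrank (by rwa [hfr]) hR₀.le (by rwa [hfr]) hu.2.1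
      (by rwa [hfr]) hv.2.1
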